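/- arXiv:2202.05034 — 2 statements merged into one kernel-verified Lean document; each statement's English description precedes it below -/
import Mathlib

section
/- Let $f\in L_p(\mathbb{T})$, $1\le p<\infty$, $r,s\in\mathbb{N}$ with $s\le 2r$, and $\alpha\in(0,s)$. Suppose the sampling operators $G_n$, $n\in\mathbb{N}$, satisfy conditions (c1), (c1'), (c2'), (c3), and in addition $(G_k(f))_{k\in\mathbb{N}}$ converges to $f$ in $L_p(\mathbb{T})$, $G_n(f)(\xi)=f(\xi)$ for all $\xi\in X_n$, and $X_n\subset X_{2n}$ for all $n$. Then the following are equivalent: (i) $\|f-G_n(f)\|_p=\mathcal{O}(n^{-\alpha})$; (ii) $\|f_{\gamma/n,\,r}-f\|_{\ell_p(X_n)}+\omega_s(f,1/n)_p=\mathcal{O}(n^{-\alpha})$; (iii) $\|(G_n(f))^{(s)}\|_p=\mathcal{O}(n^{s-\alpha})$, all as $n\to\infty$. -/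
open MeasureTheory Filter Finset

noncomputable def LpNorm (p : ℝ) (f : ℝ → ℝ) : ℝ :=
  (∫ x in (0:ℝ)..1, |f x| ^ p) ^ (1 / p)

def MemLpT (p : ℝ) (f : ℝ → ℝ) : Prop :=
  Function.Periodic f 1 ∧ Measurable f ∧
    IntervalIntegrable (fun x => |f x| ^ p) MeasureTheory.volume 0 1

noncomputable def Delta (r : ℕ) (h : ℝ) (f : ℝ → ℝ) (x : ℝ) : ℝ :=
  ∑ ν ∈ Finset.range (r + 1), ((-1 : ℝ) ^ ν * (r.choose ν : ℝ)) * f (x + ((r : ℝ) - (ν : ℝ)) * h)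

noncomputable def omegaMod (r : ℕ) (p : ℝ) (f : ℝ → ℝ) (δ : ℝ) : ℝ :=
  sSup {y | ∃ h : ℝ, 0 < h ∧ h < δ ∧ y = LpNorm p (Delta r h f)}

noncomputable def steklov (r : ℕ) (δ : ℝ) (f : ℝ → ℝ) (x : ℝ) : ℝ :=
  (-1 : ℝ) ^ (r + 1) * (((2 * r).choose r : ℝ))⁻¹ * (2 / δ) *
    ∫ t in (-(δ / 2))..(δ / 2),
      ∑ ν ∈ Finset.range r,
        (-1 : ℝ) ^ ν * (((2 * r).choose ν : ℝ)) * f (x + (((r : ℝ) - (ν : ℝ)) / (r : ℝ)) * t)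

noncomputable def ellp (p : ℝ) (n : ℕ) (x : ℕ → ℝ) (f : ℝ → ℝ) : ℝ :=
  ((1 / (n : ℝ)) * ∑ k ∈ Finset.range n, |f (x k)| ^ p) ^ (1 / p)

def SobolevW (s : ℕ) (g : ℝ → ℝ) : Prop :=
  Function.Periodic g 1 ∧ ContDiff ℝ (s : ℕ∞) g

noncomputable def localMod (r : ℕ) (f : ℝ → ℝ) (x δ : ℝ) : ℝ :=
  sSup {y | ∃ t h : ℝ, t ∈ Set.Icc (x - r * δ / 2) (x + r * δ / 2) ∧
    (t + r * h) ∈ Set.Icc (x - r * δ / 2) (x + r * δ / 2) ∧ y = |Delta r h f t|}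

noncomputable def tauMod (r : ℕ) (p : ℝ) (f : ℝ → ℝ) (δ : ℝ) : ℝ :=
  (∫ x in (0:ℝ)..1, localMod r f x δ ^ p) ^ (1 / p)

def IsTrigPoly (n : ℕ) (T : ℝ → ℝ) : Prop :=
  ∃ c : ℤ → ℂ, ∀ x : ℝ, (T x : ℂ) =
    ∑ ℓ ∈ Finset.Icc (-(n : ℤ)) (n : ℤ),
      c ℓ * Complex.exp (2 * Real.pi * Complex.I * (ℓ : ℂ) * (x : ℂ))

noncomputable def tildeE (n : ℕ) (p : ℝ) (f : ℝ → ℝ) : ℝ :=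
  sInf {y | ∃ Q q : ℝ → ℝ, IsTrigPoly n Q ∧ IsTrigPoly n q ∧
    (∀ x, q x ≤ f x ∧ f x ≤ Q x) ∧ y = LpNorm p (fun x => Q x - q x)}

noncomputable def dirichlet (n : ℕ) (x : ℝ) : ℝ :=
  ∑ ℓ ∈ Finset.Icc (-(n : ℤ)) (n : ℤ), Real.cos (2 * Real.pi * (ℓ : ℝ) * x)

noncomputable def lagrange (n : ℕ) (f : ℝ → ℝ) (x : ℝ) : ℝ :=
  (1 / (2 * (n : ℝ) + 1)) * ∑ k ∈ Finset.range (2 * n + 1),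
    f ((k : ℝ) / (2 * (n : ℝ) + 1)) * dirichlet n (x - (k : ℝ) / (2 * (n : ℝ) + 1))

def NodesOK (γ : ℝ) (X : ℕ → ℕ → ℝ) : Prop :=
  ∀ n : ℕ, 1 ≤ n →
    (0 ≤ X n 0) ∧ (∀ k, k + 1 < n → X n k < X n (k + 1)) ∧ (X n (n - 1) < 1) ∧
    (∀ k, k + 1 < n → γ / (n : ℝ) ≤ X n (k + 1) - X n k) ∧
    (γ / (n : ℝ) ≤ 1 + X n 0 - X n (n - 1))

def NodesOrd (X : ℕ → ℕ → ℝ) : Prop :=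
  ∀ n : ℕ, 1 ≤ n →
    (0 ≤ X n 0) ∧ (∀ k, k + 1 < n → X n k < X n (k + 1)) ∧ (X n (n - 1) < 1)

def SamplingForm (p : ℝ) (X : ℕ → ℕ → ℝ) (φ : ℕ → ℕ → ℝ → ℝ)
    (G : ℕ → (ℝ → ℝ) → ℝ → ℝ) : Prop :=
  (∀ n k, MemLpT p (φ n k)) ∧
  ∀ (n : ℕ) (f : ℝ → ℝ) (x : ℝ), G n f x = ∑ k ∈ Finset.range n, f (X n k) * φ n k x

def CondC1 (p K1 : ℝ) (X : ℕ → ℕ → ℝ) (G : ℕ → (ℝ → ℝ) → ℝ → ℝ) : Prop :=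
  ∀ f : ℝ → ℝ, MemLpT p f → ∀ n : ℕ, 1 ≤ n → LpNorm p (G n f) ≤ K1 * ellp p n (X n) f

def CondC1' (p K2 : ℝ) (X : ℕ → ℕ → ℝ) (G : ℕ → (ℝ → ℝ) → ℝ → ℝ) : Prop :=
  ∀ f : ℝ → ℝ, MemLpT p f → ∀ n : ℕ, 1 ≤ n → K2 * ellp p n (X n) f ≤ LpNorm p (G n f)

def CondC2' (p K3 : ℝ) (s : ℕ) (G : ℕ → (ℝ → ℝ) → ℝ → ℝ) : Prop :=
  ∀ g : ℝ → ℝ, SobolevW s g → ∀ n : ℕ, 1 ≤ n →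
    LpNorm p (fun x => g x - G n g x) ≤ K3 / (n : ℝ) ^ s * LpNorm p (iteratedDeriv s g)

def CondC3 (p K5 : ℝ) (s : ℕ) (G : ℕ → (ℝ → ℝ) → ℝ → ℝ) : Prop :=
  ∀ f : ℝ → ℝ, MemLpT p f → ∀ n : ℕ, 1 ≤ n →
    SobolevW s (G n f) ∧
    (1 / (n : ℝ) ^ s) * LpNorm p (iteratedDeriv s (G n f)) ≤
      K5 * omegaMod s p (G n f) (1 / (n : ℝ))

noncomputable def Gprev (G : ℕ → (ℝ → ℝ) → ℝ → ℝ) (f : ℝ → ℝ) (ν : ℕ) : ℝ → ℝ :=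
  if ν = 0 then fun _ => 0 else G (2 ^ (ν - 1)) f

def CondC4 (p K4 : ℝ) (s : ℕ) (G : ℕ → (ℝ → ℝ) → ℝ → ℝ) (f : ℝ → ℝ) : Prop :=
  ∀ ν : ℕ,
    SobolevW s (fun x => G (2 ^ ν) f x - Gprev G f ν x) ∧
    LpNorm p (iteratedDeriv s (fun x => G (2 ^ ν) f x - Gprev G f ν x)) ≤
      K4 * 2 ^ (s * ν) * LpNorm p (fun x => G (2 ^ ν) f x - Gprev G f ν x)

noncomputable def Kfun (s : ℕ) (p : ℝ) (n : ℕ) (x : ℕ → ℝ) (f : ℝ → ℝ) : ℝ :=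
  sInf {y | ∃ g : ℝ → ℝ, SobolevW s g ∧
    y = ellp p n x (fun t => f t - g t) + LpNorm p (fun t => f t - g t) +
        (1 / (n : ℝ) ^ s) * LpNorm p (iteratedDeriv s g)}

/-- unit-interval measure -/
noncomputable def nuT : Measure ℝ := volume.restrict (Set.Ioc (0:ℝ) 1)

instance : IsProbabilityMeasure nuT := by
  constructor
  simp [nuT]

lemma integral_nuT (f : ℝ → ℝ) : ∫ x, f x ∂nuT = ∫ x in (0:ℝ)..1, f x := by
  rw [intervalIntegral.integral_of_le zero_le_one]; rfl

noncomputable def NN (p : ℝ) (f : ℝ → ℝ) : ENNReal := eLpNorm f (ENNReal.ofReal p) nuT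

lemma NN_eq (p : ℝ) (hp : 1 ≤ p) (f : ℝ → ℝ) :
    NN p f = (∫⁻ x, ENNReal.ofReal (|f x| ^ p) ∂nuT) ^ (1 / p) := by
  unfold NN
  rw [eLpNorm_eq_lintegral_rpow_enorm_toReal (by simp; linarith) (by simp)]
  rw [ENNReal.toReal_ofReal (by linarith)]
  congr 1
  apply lintegral_congr
  intro x
  rw [Real.enorm_eq_ofReal_abs, ENNReal.ofReal_rpow_of_nonneg (abs_nonneg _) (by linarith)]

lemma memLpT_iff (p : ℝ) (hp : 1 ≤ p) (f : ℝ → ℝ) :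
    MemLpT p f ↔ Function.Periodic f 1 ∧ Measurable f ∧ NN p f ≠ ⊤ := by
  unfold MemLpT
  refine and_congr_right fun _ => and_congr_right fun hm => ?_
  rw [NN_eq p hp, intervalIntegrable_iff_integrableOn_Ioc_of_le zero_le_one]
  have hm' : Measurable fun x => |f x| ^ p := by fun_prop
  have h0 : ∀ x, 0 ≤ |f x| ^ p := fun x => by positivity
  rw [Ne, ENNReal.rpow_eq_top_iff_of_pos (by positivity), ← Ne, ← lt_top_iff_ne_top]
  constructor
  · intro h
    have := h.2
    rw [hasFiniteIntegral_iff_ofReal (ae_of_all _ h0)] at this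
    exact this
  · intro h
    refine ⟨hm'.aestronglyMeasurable, ?_⟩
    rw [hasFiniteIntegral_iff_ofReal (ae_of_all _ h0)]
    exact h

lemma LpNorm_eq (p : ℝ) (hp : 1 ≤ p) (f : ℝ → ℝ) (hm : Measurable f) :
    LpNorm p f = (NN p f).toReal := by
  rw [NN_eq p hp, ← ENNReal.toReal_rpow]
  unfold LpNorm
  congr 1
  rw [← integral_nuT, integral_eq_lintegral_of_nonneg_ae (ae_of_all _ fun x => by positivity)]
  exact (by fun_prop : Measurable fun x => |f x| ^ p).aestronglyMeasurable

lemma LpNorm_nonneg (p : ℝ) (f : ℝ → ℝ) : 0 ≤ LpNorm p f := by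
  unfold LpNorm
  apply Real.rpow_nonneg
  apply intervalIntegral.integral_nonneg zero_le_one
  intro x _; positivity

namespace MemLpT
variable {p : ℝ} {f g : ℝ → ℝ}

lemma per (hf : MemLpT p f) : Function.Periodic f 1 := hf.1
lemma meas (hf : MemLpT p f) : Measurable f := hf.2.1
lemma fin (hp : 1 ≤ p) (hf : MemLpT p f) : NN p f ≠ ⊤ := ((memLpT_iff p hp f).1 hf).2.2

lemma add (hp : 1 ≤ p) (hf : MemLpT p f) (hg : MemLpT p g) : MemLpT p (fun x => f x + g x) := by
  rw [memLpT_iff p hp]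
  refine ⟨fun x => by simp [hf.per x, hg.per x], hf.meas.add hg.meas, ?_⟩
  have : NN p (fun x => f x + g x) ≤ NN p f + NN p g :=
    eLpNorm_add_le hf.meas.aestronglyMeasurable hg.meas.aestronglyMeasurable (by simpa using hp)
  exact ne_top_of_le_ne_top (ENNReal.add_ne_top.2 ⟨hf.fin hp, hg.fin hp⟩) this

lemma cmul (hp : 1 ≤ p) (c : ℝ) (hf : MemLpT p f) : MemLpT p (fun x => c * f x) := by
  rw [memLpT_iff p hp]
  refine ⟨fun x => by simp [hf.per x], hf.meas.const_mul c, ?_⟩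
  have : NN p (fun x => c * f x) = ‖c‖ₑ * NN p f := eLpNorm_const_smul c f _ _
  rw [this]
  exact ENNReal.mul_ne_top (by simp) (hf.fin hp)

lemma sub (hp : 1 ≤ p) (hf : MemLpT p f) (hg : MemLpT p g) : MemLpT p (fun x => f x - g x) := by
  have := hf.add hp (hg.cmul hp (-1))
  convert this using 2
  ring

lemma zero (hp : 1 ≤ p) : MemLpT p (fun _ => 0) := by
  rw [memLpT_iff p hp]
  refine ⟨fun x => rfl, measurable_const, ?_⟩
  simp [NN]

lemma sum (hp : 1 ≤ p) {ι : Type*} (t : Finset ι) (F : ι → ℝ → ℝ) (h : ∀ i ∈ t, MemLpT p (F i)) :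
    MemLpT p (fun x => ∑ i ∈ t, F i x) := by
  classical
  induction t using Finset.induction_on with
  | empty => simpa using zero hp
  | insert a t ha ih =>
    simp only [Finset.sum_insert ha]
    exact (h a (by simp)).add hp (ih fun i hi => h i (by simp [hi]))

lemma of_continuous (hp : 1 ≤ p) (h1 : Function.Periodic f 1) (h2 : Continuous f) : MemLpT p f := by
  refine ⟨h1, h2.measurable, ?_⟩
  apply Continuous.intervalIntegrable
  exact h2.abs.rpow_const (fun x => Or.inr (by linarith))

end MemLpT

lemma LpNorm_add_le {p : ℝ} {f g : ℝ → ℝ} (hp : 1 ≤ p) (hf : MemLpT p f) (hg : MemLpT p g) :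
    LpNorm p (fun x => f x + g x) ≤ LpNorm p f + LpNorm p g := by
  rw [LpNorm_eq p hp _ (hf.add hp hg).meas, LpNorm_eq p hp _ hf.meas, LpNorm_eq p hp _ hg.meas,
    ← ENNReal.toReal_add (hf.fin hp) (hg.fin hp)]
  apply ENNReal.toReal_mono (ENNReal.add_ne_top.2 ⟨hf.fin hp, hg.fin hp⟩)
  exact eLpNorm_add_le hf.meas.aestronglyMeasurable hg.meas.aestronglyMeasurable (by simpa using hp)

lemma LpNorm_cmul {p : ℝ} {f : ℝ → ℝ} (hp : 1 ≤ p) (c : ℝ) (hf : MemLpT p f) :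
    LpNorm p (fun x => c * f x) = |c| * LpNorm p f := by
  rw [LpNorm_eq p hp _ (hf.cmul hp c).meas, LpNorm_eq p hp _ hf.meas]
  have : NN p (fun x => c * f x) = ‖c‖ₑ * NN p f := eLpNorm_const_smul c f _ _
  rw [this]; simp

lemma LpNorm_sub_le {p : ℝ} {f g : ℝ → ℝ} (hp : 1 ≤ p) (hf : MemLpT p f) (hg : MemLpT p g) :
    LpNorm p (fun x => f x - g x) ≤ LpNorm p f + LpNorm p g := by
  have h := LpNorm_add_le hp hf (hg.cmul hp (-1))
  rw [LpNorm_cmul hp _ hg] at h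
  simp only [abs_neg, abs_one, one_mul] at h
  convert h using 3
  ring

lemma LpNorm_sub_comm {p : ℝ} (f g : ℝ → ℝ) :
    LpNorm p (fun x => f x - g x) = LpNorm p (fun x => g x - f x) := by
  unfold LpNorm
  simp only [abs_sub_comm]

lemma LpNorm_zero {p : ℝ} (hp : 1 ≤ p) : LpNorm p (fun _ => 0) = 0 := by
  rw [LpNorm_eq p hp _ measurable_const]; simp [NN]

lemma LpNorm_sum_le {p : ℝ} (hp : 1 ≤ p) {ι : Type*} (t : Finset ι) (F : ι → ℝ → ℝ)
    (h : ∀ i ∈ t, MemLpT p (F i)) :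
    LpNorm p (fun x => ∑ i ∈ t, F i x) ≤ ∑ i ∈ t, LpNorm p (F i) := by
  classical
  induction t using Finset.induction_on with
  | empty => simp [LpNorm_zero hp]
  | insert a t ha ih =>
    simp only [Finset.sum_insert ha]
    have h' : ∀ i ∈ t, MemLpT p (F i) := fun i hi => h i (by simp [hi])
    exact (LpNorm_add_le hp (h a (by simp)) (MemLpT.sum hp t F h')).trans
      (add_le_add le_rfl (ih h'))

lemma NN_shift {p : ℝ} (hp : 1 ≤ p) {f : ℝ → ℝ} (hf : Function.Periodic f 1) (hm : Measurable f)
    (a : ℝ) : NN p (fun x => f (x + a)) = NN p f := by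
  rw [NN_eq p hp, NN_eq p hp]
  congr 1
  have h1 : ∫⁻ x, ENNReal.ofReal (|f (x + a)| ^ p) ∂nuT
      = ∫⁻ x in Set.Ioc a (a + 1), ENNReal.ofReal (|f x| ^ p) := by
    have hmp : MeasurePreserving (fun x : ℝ => x + a) volume volume :=
      measurePreserving_add_right volume a
    have := hmp.setLIntegral_comp_preimage (s := Set.Ioc a (a + 1)) measurableSet_Ioc
      (f := fun x => ENNReal.ofReal (|f x| ^ p)) (by fun_prop)
    rw [← this]
    unfold nuT
    congr 2
    ext x; simp [add_comm]
  rw [h1]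
  have := (isAddFundamentalDomain_Ioc (T := 1) one_pos a).setLIntegral_eq
    (isAddFundamentalDomain_Ioc (T := 1) one_pos 0) (fun x => ENNReal.ofReal (|f x| ^ p)) ?_
  · rw [this]; simp [nuT]
  · rintro ⟨g, hg⟩ x
    obtain ⟨k, rfl⟩ := AddSubgroup.mem_zmultiples_iff.1 hg
    have := (hf.zsmul k) x
    simp only [AddSubgroup.mk_vadd, vadd_eq_add]
    rw [add_comm, this]

lemma MemLpT.shift {p : ℝ} (hp : 1 ≤ p) {f : ℝ → ℝ} (hf : MemLpT p f) (a : ℝ) :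
    MemLpT p (fun x => f (x + a)) := by
  rw [memLpT_iff p hp]
  refine ⟨fun x => ?_, hf.meas.comp (by fun_prop), ?_⟩
  · have := hf.per (x + a)
    show f (x + 1 + a) = f (x + a)
    rw [← this]; ring_nf
  · rw [NN_shift hp hf.per hf.meas]; exact hf.fin hp

lemma LpNorm_shift {p : ℝ} (hp : 1 ≤ p) {f : ℝ → ℝ} (hf : MemLpT p f) (a : ℝ) :
    LpNorm p (fun x => f (x + a)) = LpNorm p f := by
  rw [LpNorm_eq p hp _ (hf.shift hp a).meas, LpNorm_eq p hp _ hf.meas,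
    NN_shift hp hf.per hf.meas]

/-- Minkowski -/
lemma NN_integral_le {p : ℝ} (hp : 1 ≤ p) (F : ℝ → ℝ → ℝ) (hF : Measurable (Function.uncurry F))
    (B : ENNReal) (hB : ∀ u ∈ Set.Ioc (0:ℝ) 1, NN p (fun x => F x u) ≤ B) :
    NN p (fun x => ∫ u, F x u ∂nuT) ≤ B := by
  have hp0 : 0 < p := by linarith
  have key : ∀ x, ENNReal.ofReal (|∫ u, F x u ∂nuT| ^ p)
      ≤ ∫⁻ u, ENNReal.ofReal (|F x u| ^ p) ∂nuT := by
    intro x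
    have hFx : Measurable (F x) := hF.comp (by fun_prop : Measurable fun u => (x, u))
    have h1 : ‖∫ u, F x u ∂nuT‖ₑ ≤ eLpNorm (F x) 1 nuT := by
      rw [eLpNorm_one_eq_lintegral_enorm]; exact enorm_integral_le_lintegral_enorm _
    have h2 : eLpNorm (F x) 1 nuT ≤ NN p (F x) :=
      eLpNorm_le_eLpNorm_of_exponent_le (by simpa using hp) hFx.aestronglyMeasurable
    have h3 := h1.trans h2
    rw [NN_eq p hp] at h3
    rw [← ENNReal.ofReal_rpow_of_nonneg (abs_nonneg _) hp0.le, ← Real.enorm_eq_ofReal_abs]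
    calc _ ≤ _ := ENNReal.rpow_le_rpow h3 hp0.le
      _ = _ := by rw [← ENNReal.rpow_mul]; simp [hp0.ne']
  rw [NN_eq p hp]
  have : (∫⁻ x, ENNReal.ofReal (|∫ u, F x u ∂nuT| ^ p) ∂nuT) ≤ B ^ p := by
    calc _ ≤ ∫⁻ x, ∫⁻ u, ENNReal.ofReal (|F x u| ^ p) ∂nuT ∂nuT := lintegral_mono key
      _ = ∫⁻ u, ∫⁻ x, ENNReal.ofReal (|F x u| ^ p) ∂nuT ∂nuT := by
        apply lintegral_lintegral_swap
        apply Measurable.aemeasurable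
        have : Measurable fun z : ℝ × ℝ => Function.uncurry F z := hF
        exact (this.abs.pow_const p).ennreal_ofReal
      _ ≤ ∫⁻ u, B ^ p ∂nuT := by
        apply lintegral_mono_ae
        unfold nuT
        filter_upwards [ae_restrict_mem measurableSet_Ioc] with u hu
        have := hB u hu
        rw [NN_eq p hp] at this
        calc _ = ((∫⁻ x, ENNReal.ofReal (|F x u| ^ p) ∂nuT) ^ (1 / p)) ^ p := by
              rw [← ENNReal.rpow_mul]; simp [hp0.ne', nuT]
          _ ≤ _ := ENNReal.rpow_le_rpow this hp0.le
      _ = _ := by simp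
  calc _ ≤ (B ^ p) ^ (1 / p) := ENNReal.rpow_le_rpow this (by positivity)
    _ = B := by rw [← ENNReal.rpow_mul]; simp [hp0.ne']

lemma LpNorm_integral_le {p : ℝ} (hp : 1 ≤ p) (F : ℝ → ℝ → ℝ)
    (hF : Measurable (Function.uncurry F)) (hmem : ∀ u, MemLpT p (fun x => F x u))
    (B : ℝ) (hB : ∀ u ∈ Set.Ioc (0:ℝ) 1, LpNorm p (fun x => F x u) ≤ B) :
    MemLpT p (fun x => ∫ u in (0:ℝ)..1, F x u) ∧
    LpNorm p (fun x => ∫ u in (0:ℝ)..1, F x u) ≤ B := by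
  have hB0 : 0 ≤ B := (LpNorm_nonneg _ _).trans (hB 1 (by simp))
  have hh : NN p (fun x => ∫ u, F x u ∂nuT) ≤ ENNReal.ofReal B := by
    apply NN_integral_le hp F hF
    intro u hu
    have := hB u hu
    rw [LpNorm_eq p hp _ (hmem u).meas] at this
    exact (ENNReal.le_ofReal_iff_toReal_le ((hmem u).fin hp) hB0).2 this
  simp_rw [← integral_nuT]
  have hme : Measurable (fun x => ∫ u, F x u ∂nuT) :=
    (hF.stronglyMeasurable.integral_prod_right (ν := nuT)).measurable
  refine ⟨(memLpT_iff p hp _).2 ⟨?_, hme, ne_top_of_le_ne_top (by simp) hh⟩, ?_⟩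
  · intro x
    simp only
    congr 1
    ext u
    exact (hmem u).per x
  · rw [LpNorm_eq p hp _ hme]
    exact ENNReal.toReal_le_of_le_ofReal hB0 hh

lemma MemLpT.intervalIntegrable {p : ℝ} (hp : 1 ≤ p) {f : ℝ → ℝ} (hf : MemLpT p f) (a b : ℝ) :
    IntervalIntegrable f volume a b := by
  apply hf.per.intervalIntegrable₀ one_ne_zero
  rw [intervalIntegrable_iff_integrableOn_Ioc_of_le zero_le_one]
  have : MemLp f (ENNReal.ofReal p) nuT :=
    ⟨hf.meas.aestronglyMeasurable, lt_top_iff_ne_top.2 (hf.fin hp)⟩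
  exact this.integrable (by simpa using hp)

lemma MemLpT.intervalIntegrable_pow {p : ℝ} {f : ℝ → ℝ} (hf : MemLpT p f) (a b : ℝ) :
    IntervalIntegrable (fun x => |f x| ^ p) volume a b := by
  have : Function.Periodic (fun x => |f x| ^ p) 1 := fun x => by simp [hf.per x]
  exact this.intervalIntegrable₀ one_ne_zero hf.2.2 a b

lemma Delta_eq_fwd (m : ℕ) (h : ℝ) (f : ℝ → ℝ) : Delta m h f = (fwdDiff h)^[m] f := by
  ext y
  rw [fwdDiff_iter_eq_sum_shift]
  unfold Delta
  rw [← Finset.sum_range_reflect]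
  apply Finset.sum_congr rfl
  intro k hk
  have hk' : k ≤ m := by simpa [Nat.lt_succ_iff] using hk
  have e : m + 1 - 1 - k = m - k := by omega
  rw [e, Nat.choose_symm hk', Nat.cast_sub hk']
  simp

lemma Delta_succ (m : ℕ) (h : ℝ) (f : ℝ → ℝ) (x : ℝ) :
    Delta (m + 1) h f x = Delta m h f (x + h) - Delta m h f x := by
  rw [Delta_eq_fwd, Function.iterate_succ_apply', fwdDiff, Delta_eq_fwd]

lemma Delta_succ' (m : ℕ) (h : ℝ) (f : ℝ → ℝ) :
    Delta (m + 1) h f = Delta m h (fun x => f (x + h) - f x) := by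
  rw [Delta_eq_fwd, Function.iterate_succ_apply, Delta_eq_fwd]; rfl

lemma Delta_zero (h : ℝ) (f : ℝ → ℝ) : Delta 0 h f = f := by
  rw [Delta_eq_fwd]; rfl

lemma Delta_sub (m : ℕ) (h : ℝ) (f g : ℝ → ℝ) (x : ℝ) :
    Delta m h (fun y => f y - g y) x = Delta m h f x - Delta m h g x := by
  unfold Delta
  rw [← Finset.sum_sub_distrib]
  apply Finset.sum_congr rfl
  intros; ring

lemma MemLpT.Delta {p : ℝ} (hp : 1 ≤ p) {f : ℝ → ℝ} (hf : MemLpT p f) (m : ℕ) (h : ℝ) :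
    MemLpT p (Delta m h f) := by
  induction m with
  | zero => rwa [Delta_zero]
  | succ m ih =>
    have : _root_.Delta (m + 1) h f = fun x => _root_.Delta m h f (x + h) - _root_.Delta m h f x := by
      ext x; exact Delta_succ m h f x
    rw [this]
    exact (ih.shift hp h).sub hp ih

lemma LpNorm_Delta_le {p : ℝ} (hp : 1 ≤ p) {f : ℝ → ℝ} (hf : MemLpT p f) (m : ℕ) (h : ℝ) :
    LpNorm p (Delta m h f) ≤ 2 ^ m * LpNorm p f := by
  induction m with
  | zero => simp [Delta_zero]
  | succ m ih =>
    have : _root_.Delta (m + 1) h f = fun x => _root_.Delta m h f (x + h) - _root_.Delta m h f x := by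
      ext x; exact Delta_succ m h f x
    rw [this]
    have hm := hf.Delta hp m h
    calc _ ≤ _ := LpNorm_sub_le hp (hm.shift hp h) hm
      _ = 2 * LpNorm p (Delta m h f) := by rw [LpNorm_shift hp hm]; ring
      _ ≤ _ := by rw [pow_succ]; linarith

lemma LpNorm_Delta_le_omega {p : ℝ} (hp : 1 ≤ p) {f : ℝ → ℝ} (hf : MemLpT p f) (m : ℕ) {h δ : ℝ}
    (h0 : 0 < h) (h1 : h < δ) : LpNorm p (Delta m h f) ≤ omegaMod m p f δ := by
  unfold omegaMod
  apply le_csSup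
  · refine ⟨2 ^ m * LpNorm p f, ?_⟩
    rintro y ⟨h, _, _, rfl⟩
    exact LpNorm_Delta_le hp hf m h
  · exact ⟨h, h0, h1, rfl⟩

lemma omega_le {p : ℝ} {f : ℝ → ℝ} (m : ℕ) {δ B : ℝ} (hB : 0 ≤ B)
    (h : ∀ h, 0 < h → h < δ → LpNorm p (Delta m h f) ≤ B) : omegaMod m p f δ ≤ B := by
  unfold omegaMod
  apply Real.sSup_le _ hB
  rintro y ⟨t, h0, h1, rfl⟩
  exact h t h0 h1

lemma omega_nonneg {p : ℝ} {f : ℝ → ℝ} (m : ℕ) {δ : ℝ} : 0 ≤ omegaMod m p f δ := by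
  unfold omegaMod
  apply Real.sSup_nonneg
  rintro y ⟨t, h0, h1, rfl⟩
  exact LpNorm_nonneg _ _

lemma omega_le_add {p : ℝ} (hp : 1 ≤ p) {f g : ℝ → ℝ} (hf : MemLpT p f) (hg : MemLpT p g) (m : ℕ)
    (δ : ℝ) : omegaMod m p f δ ≤ 2 ^ m * LpNorm p (fun x => f x - g x) + omegaMod m p g δ := by
  apply omega_le
  · have := LpNorm_nonneg p (fun x => f x - g x)
    have := omega_nonneg (p := p) (f := g) m (δ := δ)
    positivity
  · intro h h0 h1
    have e : Delta m h f = fun x => Delta m h (fun y => f y - g y) x + Delta m h g x := by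
      ext x; rw [Delta_sub]; ring
    rw [e]
    exact (LpNorm_add_le hp ((hf.sub hp hg).Delta hp m h) (hg.Delta hp m h)).trans
      (add_le_add (LpNorm_Delta_le hp (hf.sub hp hg) m h) (LpNorm_Delta_le_omega hp hg m h0 h1))

lemma SobolevW.mem {p : ℝ} (hp : 1 ≤ p) {s : ℕ} {g : ℝ → ℝ} (hg : SobolevW s g) : MemLpT p g :=
  MemLpT.of_continuous hp hg.1 hg.2.continuous

lemma periodic_iteratedDeriv {g : ℝ → ℝ} (hg : Function.Periodic g 1) (s : ℕ) :
    Function.Periodic (iteratedDeriv s g) 1 := by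
  intro x
  have h : (fun z => g (z + 1)) = g := funext hg
  have := congrFun (iteratedDeriv_comp_add_const s g 1) x
  rw [h] at this
  exact this.symm

lemma SobolevW.mem_deriv {p : ℝ} (hp : 1 ≤ p) {s : ℕ} {g : ℝ → ℝ} (hg : SobolevW s g) :
    MemLpT p (iteratedDeriv s g) :=
  MemLpT.of_continuous hp (periodic_iteratedDeriv hg.1 s)
    (hg.2.continuous_iteratedDeriv s le_rfl)

lemma LpNorm_D1_le {p : ℝ} (hp : 1 ≤ p) {g : ℝ → ℝ} (hg : Function.Periodic g 1)
    (hc : ContDiff ℝ 1 g) {h : ℝ} (h0 : 0 < h) :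
    LpNorm p (fun x => g (x + h) - g x) ≤ h * LpNorm p (deriv g) := by
  have hd : Continuous (deriv g) := hc.continuous_deriv le_rfl
  have hdp : MemLpT p (deriv g) := by
    have := periodic_iteratedDeriv hg 1
    rw [iteratedDeriv_one] at this
    exact MemLpT.of_continuous hp this hd
  have e : (fun x => g (x + h) - g x) = fun x => ∫ u in (0:ℝ)..1, h * deriv g (x + h * u) := by
    ext x
    rw [intervalIntegral.integral_const_mul, intervalIntegral.integral_comp_add_mul _ h0.ne',
      intervalIntegral.integral_deriv_eq_sub]
    · simp [h0.ne']
    · intro y _; exact (hc.differentiable one_ne_zero) y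
    · exact hd.intervalIntegrable _ _
  rw [e]
  refine (LpNorm_integral_le hp (fun x u => h * deriv g (x + h * u)) ?_ ?_ _ ?_).2
  · apply Continuous.measurable
    exact continuous_const.mul (hd.comp (by fun_prop))
  · intro u
    exact (hdp.shift hp (h * u)).cmul hp h
  · intro u _
    rw [LpNorm_cmul hp _ (hdp.shift hp (h * u)), LpNorm_shift hp hdp, abs_of_pos h0]

lemma contDiff_shift {n : WithTop ℕ∞} {g : ℝ → ℝ} (hg : ContDiff ℝ n g) (h : ℝ) :
    ContDiff ℝ n (fun x => g (x + h)) := hg.comp (contDiff_id.add contDiff_const)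

lemma iteratedDeriv_D1 {s : ℕ} {g : ℝ → ℝ} (hg : ContDiff ℝ s g) (h : ℝ) :
    iteratedDeriv s (fun x => g (x + h) - g x) =
      fun x => iteratedDeriv s g (x + h) - iteratedDeriv s g x := by
  ext x
  have := iteratedDeriv_sub (n := s) (x := x) (contDiff_shift hg h).contDiffAt hg.contDiffAt
  rw [iteratedDeriv_comp_add_const] at this
  exact this

lemma LpNorm_Delta_le_deriv {p : ℝ} (hp : 1 ≤ p) {h : ℝ} (h0 : 0 < h) (s : ℕ) :
    ∀ {g : ℝ → ℝ}, SobolevW s g → LpNorm p (Delta s h g) ≤ h ^ s * LpNorm p (iteratedDeriv s g) := by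
  induction s with
  | zero => intro g _; simp [Delta_zero]
  | succ s ih =>
    rintro g ⟨hg1, hg2⟩
    have hg2' : ContDiff ℝ ((s + 1 : ℕ) : ℕ∞) g := hg2
    have hgs : ContDiff ℝ s g := hg2.of_le (by exact_mod_cast Nat.le_succ s)
    rw [Delta_succ']
    have hW : SobolevW s (fun x => g (x + h) - g x) := by
      refine ⟨fun x => ?_, (contDiff_shift hgs h).sub hgs⟩
      have := hg1 (x + h)
      simp only [hg1 x]
      rw [← this]; ring_nf
    have h1 := ih hW
    rw [iteratedDeriv_D1 hgs] at h1
    have hc1 : ContDiff ℝ 1 (iteratedDeriv s g) := by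
      rw [iteratedDeriv_eq_iterate]
      have hg3 : ContDiff ℝ ((1 + s : ℕ) : WithTop ℕ∞) g := by rw [add_comm]; exact hg2
      exact_mod_cast ContDiff.iterate_deriv' 1 s hg3
    have h2 := LpNorm_D1_le hp (periodic_iteratedDeriv hg1 s) hc1 h0
    rw [← iteratedDeriv_succ] at h2
    calc _ ≤ _ := h1
      _ ≤ h ^ s * (h * LpNorm p (iteratedDeriv (s + 1) g)) := by gcongr
      _ = _ := by ring

lemma omega_le_deriv {p : ℝ} (hp : 1 ≤ p) {δ : ℝ} (h0 : 0 < δ) (s : ℕ) {g : ℝ → ℝ}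
    (hg : SobolevW s g) : omegaMod s p g δ ≤ δ ^ s * LpNorm p (iteratedDeriv s g) := by
  have hn := LpNorm_nonneg p (iteratedDeriv s g)
  apply omega_le _ (by positivity)
  intro h h1 h2
  exact (LpNorm_Delta_le_deriv hp h1 s hg).trans (by gcongr)

noncomputable def SS (c : ℝ) (f : ℝ → ℝ) (x : ℝ) : ℝ := ∫ u in (0:ℝ)..1, f (x + c * u)

lemma SS_mem_le {p : ℝ} (hp : 1 ≤ p) {f : ℝ → ℝ} (hf : MemLpT p f) (c : ℝ) :
    MemLpT p (SS c f) ∧ LpNorm p (SS c f) ≤ LpNorm p f := by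
  refine LpNorm_integral_le hp (fun x u => f (x + c * u)) ?_ ?_ _ ?_
  · exact hf.meas.comp (by fun_prop : Measurable fun z : ℝ × ℝ => z.1 + c * z.2)
  · intro u; exact hf.shift hp (c * u)
  · intro u _; rw [LpNorm_shift hp hf]

lemma SS_iter_mem {p : ℝ} (hp : 1 ≤ p) {f : ℝ → ℝ} (hf : MemLpT p f) (c : ℝ) (k : ℕ) :
    MemLpT p ((SS c)^[k] f) := by
  induction k with
  | zero => exact hf
  | succ k ih => rw [Function.iterate_succ_apply']; exact (SS_mem_le hp ih c).1

lemma SS_zero (f : ℝ → ℝ) : SS 0 f = f := by ext x; simp [SS]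

lemma MemLpT.ii_comp {p : ℝ} (hp : 1 ≤ p) {f : ℝ → ℝ} (hf : MemLpT p f) (x c a b : ℝ) :
    IntervalIntegrable (fun u => f (x + c * u)) volume a b := by
  rcases eq_or_ne c 0 with rfl | hc
  · simp
  · have h1 := (hf.intervalIntegrable hp (x + c * a) (x + c * b)).comp_add_left (c := x)
    have h2 := h1.comp_mul_left (c := c)
    convert h2 using 1 <;> field_simp <;> ring

lemma SS_eq {c : ℝ} (hc : c ≠ 0) (f : ℝ → ℝ) (x : ℝ) :
    SS c f x = c⁻¹ * ∫ t in x..(x + c), f t := by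
  unfold SS
  rw [intervalIntegral.integral_comp_add_mul _ hc]; simp

lemma SS_continuous {p : ℝ} (hp : 1 ≤ p) {f : ℝ → ℝ} (hf : MemLpT p f) {c : ℝ} (hc : c ≠ 0) :
    Continuous (SS c f) := by
  have hi := fun a b => hf.intervalIntegrable hp a b
  have e : SS c f = fun x => c⁻¹ * ((∫ t in (0:ℝ)..(x + c), f t) - ∫ t in (0:ℝ)..x, f t) := by
    ext x
    rw [SS_eq hc, intervalIntegral.integral_interval_sub_left (hi _ _) (hi _ _)]
  rw [e]
  have := intervalIntegral.continuous_primitive hi 0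
  exact continuous_const.mul ((this.comp (continuous_id.add continuous_const)).sub this)

lemma SS_hasDerivAt {u : ℝ → ℝ} (hu : Continuous u) {c : ℝ} (hc : c ≠ 0) (x : ℝ) :
    HasDerivAt (SS c u) (c⁻¹ * (u (x + c) - u x)) x := by
  have hi := fun a b => hu.intervalIntegrable (μ := volume) a b
  have e : SS c u = fun x => c⁻¹ * ((∫ t in (0:ℝ)..(x + c), u t) - ∫ t in (0:ℝ)..x, u t) := by
    ext x
    rw [SS_eq hc, intervalIntegral.integral_interval_sub_left (hi _ _) (hi _ _)]
  rw [e]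
  apply HasDerivAt.const_mul
  apply HasDerivAt.sub
  · have := hu.integral_hasStrictDerivAt 0 (x + c)
    exact this.hasDerivAt.comp_add_const x c
  · exact (hu.integral_hasStrictDerivAt 0 x).hasDerivAt

lemma SS_deriv {u : ℝ → ℝ} (hu : Continuous u) {c : ℝ} (hc : c ≠ 0) :
    deriv (SS c u) = fun x => c⁻¹ * (u (x + c) - u x) :=
  funext fun x => (SS_hasDerivAt hu hc x).deriv

lemma SS_contDiff {u : ℝ → ℝ} {k : ℕ} (hu : ContDiff ℝ k u) {c : ℝ} (hc : c ≠ 0) :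
    ContDiff ℝ (k + 1 : ℕ) (SS c u) := by
  push_cast
  rw [contDiff_succ_iff_deriv]
  refine ⟨fun x => (SS_hasDerivAt hu.continuous hc x).differentiableAt, by simp, ?_⟩
  rw [SS_deriv hu.continuous hc]
  exact contDiff_const.mul ((contDiff_shift hu c).sub hu)

lemma SS_iter_contDiff {u : ℝ → ℝ} (hu : Continuous u) {c : ℝ} (hc : c ≠ 0) (k : ℕ) :
    ContDiff ℝ k ((SS c)^[k] u) := by
  induction k with
  | zero => simpa using hu
  | succ k ih => rw [Function.iterate_succ_apply']; exact SS_contDiff ih hc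

lemma SS_iter_deriv {u : ℝ → ℝ} (hu : Continuous u) {c : ℝ} (hc : c ≠ 0) (k : ℕ) :
    iteratedDeriv k ((SS c)^[k] u) = fun x => (c⁻¹) ^ k * Delta k c u x := by
  induction k with
  | zero => simp [Delta_zero]
  | succ k ih =>
    have hk := SS_iter_contDiff hu hc k
    rw [Function.iterate_succ_apply', iteratedDeriv_succ', SS_deriv hk.continuous hc]
    ext x
    rw [iteratedDeriv_const_mul_field, iteratedDeriv_D1 hk, ih]
    simp only [Delta_succ]
    ring

lemma Delta_SS {p : ℝ} (hp : 1 ≤ p) {f : ℝ → ℝ} (hf : MemLpT p f) (m : ℕ) (h c : ℝ) :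
    Delta m h (SS c f) = SS c (Delta m h f) := by
  ext x
  unfold Delta SS
  rw [intervalIntegral.integral_finsetSum]
  · apply Finset.sum_congr rfl
    intro i _
    rw [intervalIntegral.integral_const_mul]
    congr 2
    ext u
    congr 1; ring
  · intro i _
    apply IntervalIntegrable.const_mul
    have := hf.ii_comp hp (x + ((m:ℝ) - i) * h) c 0 1
    convert this using 3
    ring

/-- one averaging step -/
lemma avg_step {p : ℝ} (hp : 1 ≤ p) (s : ℕ) (w : ℕ → ℝ) (u : ℕ → ℝ → ℝ) (hu : ∀ j, MemLpT p (u j))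
    {h b B : ℝ} (h0 : 0 < h)
    (H : ∀ τ, 0 ≤ τ → τ ≤ b →
      LpNorm p (fun x => ∑ j ∈ range (s + 1), w j * u j (x + j * τ)) ≤ B)
    (τ : ℝ) (hτ0 : 0 ≤ τ) (hτ : τ ≤ b - h) :
    LpNorm p (fun x => ∑ j ∈ range (s + 1), w j * SS (j * h) (u j) (x + j * τ)) ≤ B := by
  have e : (fun x => ∑ j ∈ range (s + 1), w j * SS (j * h) (u j) (x + j * τ)) =
      fun x => ∫ v in (0:ℝ)..1, ∑ j ∈ range (s + 1), w j * u j (x + j * (τ + h * v)) := by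
    ext x
    rw [intervalIntegral.integral_finsetSum]
    · apply Finset.sum_congr rfl
      intro j _
      rw [intervalIntegral.integral_const_mul]
      unfold SS
      congr 2
      ext v
      congr 1; ring
    · intro j _
      apply IntervalIntegrable.const_mul
      have := (hu j).ii_comp hp (x + j * τ) (j * h) 0 1
      convert this using 3
      ring
  rw [e]
  refine (LpNorm_integral_le hp
    (fun x v => ∑ j ∈ range (s + 1), w j * u j (x + j * (τ + h * v))) ?_ ?_ _ ?_).2
  · apply Finset.measurable_sum
    intro j _
    apply Measurable.const_mul
    exact (hu j).meas.comp (by fun_prop : Measurable fun z : ℝ × ℝ => z.1 + j * (τ + h * z.2))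
  · intro v
    exact MemLpT.sum hp _ _ fun j _ => ((hu j).shift hp _).cmul hp _
  · intro v hv
    apply H
    · have := hv.1; positivity
    · have := mul_le_mul_of_nonneg_left hv.2 h0.le
      linarith

lemma avg_iter {p : ℝ} (hp : 1 ≤ p) (s : ℕ) (w : ℕ → ℝ) {f : ℝ → ℝ} (hf : MemLpT p f)
    {h b B : ℝ} (h0 : 0 < h)
    (H : ∀ τ, 0 ≤ τ → τ ≤ b →
      LpNorm p (fun x => ∑ j ∈ range (s + 1), w j * f (x + j * τ)) ≤ B) (k : ℕ) :
    ∀ τ : ℝ, 0 ≤ τ → τ ≤ b - k * h →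
    LpNorm p (fun x => ∑ j ∈ range (s + 1), w j * ((SS (j * h))^[k] f) (x + j * τ)) ≤ B := by
  induction k with
  | zero => simpa using H
  | succ k ih =>
    intro τ h1 h2
    simp only [Function.iterate_succ_apply']
    apply avg_step hp s w (fun j => (SS (j * h))^[k] f) (fun j => SS_iter_mem hp hf _ k) h0 ih τ h1
    push_cast at h2
    linarith

lemma kfun_exists {p : ℝ} (hp : 1 ≤ p) {s : ℕ} (hs : 1 ≤ s) {f : ℝ → ℝ} (hf : MemLpT p f)
    {n : ℕ} (hn : 1 ≤ n) :
    ∃ g, SobolevW s g ∧ LpNorm p (fun x => f x - g x) ≤ omegaMod s p f (1 / n) ∧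
      (1 / (n:ℝ) ^ s) * LpNorm p (iteratedDeriv s g) ≤
        (2 ^ s * ((s:ℝ) + 2) ^ s) * omegaMod s p f (1 / n) := by
  have hn0 : (0:ℝ) < n := by exact_mod_cast hn
  set ω := omegaMod s p f (1 / n) with hω
  have hω0 : 0 ≤ ω := omega_nonneg s
  set h : ℝ := 1 / (n * (s + 2)) with hh
  have h0 : 0 < h := by positivity
  set w : ℕ → ℝ := fun j => (-1) ^ j * (s.choose j : ℝ) with hw
  have hDelta : ∀ τ x, Delta s τ f x = (-1) ^ s * ∑ j ∈ range (s + 1), w j * f (x + j * τ) := by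
    intro τ x
    unfold Delta
    rw [← Finset.sum_range_reflect, Finset.mul_sum]
    apply Finset.sum_congr rfl
    intro j hj
    have hj' : j ≤ s := by simpa [Nat.lt_succ_iff] using hj
    have e : s + 1 - 1 - j = s - j := by omega
    have e2 : (-1:ℝ) ^ (s - j) = (-1) ^ s * (-1) ^ j := by
      have : (-1:ℝ) ^ s = (-1) ^ (s - j) * (-1) ^ j := by rw [← pow_add]; congr 1; omega
      rw [this, mul_assoc, ← mul_pow]; simp
    rw [e, Nat.choose_symm hj', Nat.cast_sub hj', e2, hw]
    simp only [sub_sub_cancel]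
    ring
  have H : ∀ τ, 0 ≤ τ → τ ≤ (s + 1) * h →
      LpNorm p (fun x => ∑ j ∈ range (s + 1), w j * f (x + j * τ)) ≤ ω := by
    intro τ h1 h2
    have e : (fun x => ∑ j ∈ range (s + 1), w j * f (x + j * τ)) =
        fun x => (-1) ^ s * Delta s τ f x := by
      ext x
      rw [hDelta, ← mul_assoc, ← mul_pow]; simp
    rw [e, LpNorm_cmul hp _ (hf.Delta hp s τ)]
    simp only [abs_pow, abs_neg, abs_one, one_pow, one_mul]
    rcases h1.eq_or_lt with rfl | h1
    · have : Delta s 0 f = fun _ => 0 := by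
        obtain ⟨m, rfl⟩ := Nat.exists_eq_add_of_le' hs
        ext x; rw [Delta_succ]; simp
      rw [this, LpNorm_zero hp]; exact hω0
    · apply LpNorm_Delta_le_omega hp hf s h1
      refine h2.trans_lt ?_
      rw [hh]
      field_simp
      linarith
  have H2 := avg_iter hp s w hf h0 H (s + 1) 0 le_rfl (by push_cast; simp)
  simp only [mul_zero, add_zero] at H2
  have hcd : ∀ j ∈ Finset.Ico 1 (s + 1), SobolevW s ((SS (j * h))^[s + 1] f) := by
    intro j hj
    have hj1 : 1 ≤ j := (Finset.mem_Ico.1 hj).1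
    have hc : (j * h : ℝ) ≠ 0 := by
      have : (0:ℝ) < j := by exact_mod_cast hj1
      positivity
    refine ⟨(SS_iter_mem hp hf _ _).per, ?_⟩
    rw [Function.iterate_succ_apply]
    exact SS_iter_contDiff (SS_continuous hp hf hc) hc s
  have hW : SobolevW s (fun x => ∑ j ∈ Finset.Ico 1 (s + 1), -w j * ((SS (j * h))^[s + 1] f) x) := by
    constructor
    · intro x
      apply Finset.sum_congr rfl
      intro j hj
      rw [(hcd j hj).1 x]
    · apply ContDiff.sum
      intro j hj
      exact contDiff_const.mul (hcd j hj).2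
  refine ⟨fun x => ∑ j ∈ Finset.Ico 1 (s + 1), -w j * ((SS (j * h))^[s + 1] f) x, hW, ?_, ?_⟩
  · convert H2 using 3 with x
    rw [Finset.range_eq_Ico, Finset.sum_eq_sum_Ico_succ_bot (by omega)]
    have : (SS ((0:ℕ) * h))^[s + 1] f = f := by
      simp only [Nat.cast_zero, zero_mul]
      exact Function.iterate_fixed (SS_zero f) _
    rw [this]
    simp [hw]
  · have hd : iteratedDeriv s (fun x => ∑ j ∈ Finset.Ico 1 (s + 1),
        -w j * ((SS (j * h))^[s + 1] f) x) = fun x => ∑ j ∈ Finset.Ico 1 (s + 1),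
          -w j * iteratedDeriv s ((SS (j * h))^[s + 1] f) x := by
      ext x
      rw [iteratedDeriv_fun_sum]
      · apply Finset.sum_congr rfl
        intro j hj
        rw [iteratedDeriv_const_mul_field]
      · intro j hj
        exact (contDiff_const.mul (hcd j hj).2).contDiffAt
    rw [hd]
    have hterm : ∀ j ∈ Finset.Ico 1 (s + 1),
        LpNorm p (iteratedDeriv s ((SS (j * h))^[s + 1] f)) ≤ (n * (s + 2)) ^ s * ω := by
      intro j hj
      have hj1 : 1 ≤ j := (Finset.mem_Ico.1 hj).1
      have hj2 : j ≤ s := by have := (Finset.mem_Ico.1 hj).2; omega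
      have hj0 : (1:ℝ) ≤ j := by exact_mod_cast hj1
      have hj3 : (j:ℝ) ≤ s := by exact_mod_cast hj2
      have hcp : (0:ℝ) < j * h := by positivity
      rw [Function.iterate_succ_apply, SS_iter_deriv (SS_continuous hp hf hcp.ne') hcp.ne',
        LpNorm_cmul hp _ ((SS_mem_le hp hf _).1.Delta hp _ _), Delta_SS hp hf]
      have h1 := (SS_mem_le hp (hf.Delta hp s (j * h)) (j * h)).2
      have h2 : LpNorm p (Delta s (j * h) f) ≤ ω := by
        apply LpNorm_Delta_le_omega hp hf s hcp
        rw [hh]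
        field_simp
        linarith
      have h3 : |((j * h : ℝ)⁻¹) ^ s| ≤ (n * (s + 2)) ^ s := by
        rw [abs_of_nonneg (by positivity)]
        gcongr
        rw [hh]
        rw [inv_le_comm₀ (by positivity) (by positivity), ← one_div]
        exact le_mul_of_one_le_left (by positivity) hj0
      exact mul_le_mul h3 (h1.trans h2) (LpNorm_nonneg _ _) (by positivity)
    have hsum : LpNorm p (fun x => ∑ j ∈ Finset.Ico 1 (s + 1),
          -w j * iteratedDeriv s ((SS (j * h))^[s + 1] f) x) ≤ 2 ^ s * ((n * (s + 2)) ^ s * ω) := by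
      have hm := fun j hj => (hcd j hj).mem_deriv hp
      refine (LpNorm_sum_le hp _ _ fun j hj => (hm j hj).cmul hp _).trans ?_
      calc _ ≤ ∑ j ∈ Finset.Ico 1 (s + 1), (s.choose j : ℝ) * ((n * (s + 2)) ^ s * ω) := by
            apply Finset.sum_le_sum
            intro j hj
            rw [LpNorm_cmul hp _ (hm j hj)]
            have : |-w j| = (s.choose j : ℝ) := by simp [hw, abs_mul]
            rw [this]
            exact mul_le_mul_of_nonneg_left (hterm j hj) (by positivity)
        _ ≤ ∑ j ∈ range (s + 1), (s.choose j : ℝ) * ((n * (s + 2)) ^ s * ω) := by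
            apply Finset.sum_le_sum_of_subset_of_nonneg
            · intro j hj; simp at hj ⊢; omega
            · intros; positivity
        _ = _ := by
            rw [← Finset.sum_mul]
            congr 1
            exact_mod_cast Nat.sum_range_choose s
    calc _ ≤ (1 / (n:ℝ) ^ s) * (2 ^ s * ((n * (s + 2)) ^ s * ω)) :=
          mul_le_mul_of_nonneg_left hsum (by positivity)
      _ = _ := by rw [mul_pow]; field_simp

lemma MemLpT.pow_mem {p : ℝ} {w : ℝ → ℝ} (hw : MemLpT p w) :
    MemLpT 1 (fun x => |w x| ^ p) := by
  refine ⟨fun x => by simp [hw.per x], (hw.meas.abs.pow_const p), ?_⟩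
  have : (fun x => |(|w x| ^ p)| ^ (1:ℝ)) = fun x => |w x| ^ p := by
    ext x; rw [Real.rpow_one, abs_of_nonneg (by positivity)]
  rw [this]; exact hw.2.2

lemma MemLpT.abs_mem {p : ℝ} {w : ℝ → ℝ} (hw : MemLpT p w) : MemLpT p (fun x => |w x|) := by
  refine ⟨fun x => by simp [hw.per x], hw.meas.abs, ?_⟩
  simpa using hw.2.2

lemma jensen_local {p : ℝ} (hp : 1 ≤ p) {w : ℝ → ℝ} (hw : MemLpT p w) (a δ : ℝ) (hδ : 0 < δ) :
    ((1 / δ) * ∫ x in a..(a + δ), |w x|) ^ p ≤ (1 / δ) * ∫ x in a..(a + δ), |w x| ^ p := by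
  have e1 : (1 / δ) * ∫ x in a..(a + δ), |w x| = ∫ u, |w (a + δ * u)| ∂nuT := by
    rw [integral_nuT, intervalIntegral.integral_comp_add_mul (fun x => |w x|) hδ.ne']; simp
  have e2 : (1 / δ) * ∫ x in a..(a + δ), |w x| ^ p = ∫ u, |w (a + δ * u)| ^ p ∂nuT := by
    rw [integral_nuT, intervalIntegral.integral_comp_add_mul (fun x => |w x| ^ p) hδ.ne']; simp
  rw [e1, e2]
  have i1 : Integrable (fun u => |w (a + δ * u)|) nuT := by
    have := hw.abs_mem.ii_comp hp a δ 0 1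
    rwa [intervalIntegrable_iff_integrableOn_Ioc_of_le zero_le_one] at this
  have i2 : Integrable (fun u => |w (a + δ * u)| ^ p) nuT := by
    have := hw.pow_mem.ii_comp le_rfl a δ 0 1
    rwa [intervalIntegrable_iff_integrableOn_Ioc_of_le zero_le_one] at this
  have := (convexOn_rpow hp).map_integral_le (μ := nuT) (f := fun u => |w (a + δ * u)|)
    (Real.continuous_rpow_const (by linarith)).continuousOn isClosed_Ici
    (ae_of_all _ fun u => Set.mem_Ici.2 (abs_nonneg _)) i1 i2
  exact this

lemma sum_intervals_le {γ : ℝ} {X : ℕ → ℕ → ℝ} (hX : NodesOK γ X)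
    {n : ℕ} (hn : 1 ≤ n) {ψ : ℝ → ℝ} (hψ0 : ∀ x, 0 ≤ ψ x)
    (hψ : ∀ a b, IntervalIntegrable ψ volume a b) (hper : Function.Periodic ψ 1)
    {δ : ℝ} (hδ : δ = γ / n) :
    ∑ k ∈ range n, ∫ x in (X n k - δ / 2)..(X n k - δ / 2 + δ), ψ x ≤ ∫ x in (0:ℝ)..1, ψ x := by
  obtain ⟨h0, hmono, hlast, hgap, hwrap⟩ := hX n hn
  rw [← hδ] at hgap hwrap
  have key : ∀ m, m + 1 ≤ n →
      ∑ k ∈ range (m + 1), ∫ x in (X n k - δ / 2)..(X n k - δ / 2 + δ), ψ x ≤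
        ∫ x in (X n 0 - δ / 2)..(X n m + δ / 2), ψ x := by
    intro m
    induction m with
    | zero =>
      intro _
      simp only [zero_add, Finset.range_one, Finset.sum_singleton]
      apply le_of_eq; congr 1; ring
    | succ m ih =>
      intro hm
      rw [Finset.sum_range_succ]
      have h1 := ih (by omega)
      have h2 := hgap m (by omega)
      have e1 : X n (m + 1) - δ / 2 + δ = X n (m + 1) + δ / 2 := by ring
      rw [e1]
      have h3 : 0 ≤ ∫ x in (X n m + δ / 2)..(X n (m + 1) - δ / 2), ψ x :=
        intervalIntegral.integral_nonneg (by linarith) fun x _ => hψ0 x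
      rw [← intervalIntegral.integral_add_adjacent_intervals (hψ (X n 0 - δ / 2) (X n m + δ / 2))
        (hψ _ _), ← intervalIntegral.integral_add_adjacent_intervals
        (hψ (X n m + δ / 2) (X n (m + 1) - δ / 2)) (hψ _ _)]
      linarith
  obtain ⟨m, rfl⟩ := Nat.exists_eq_add_of_le' hn
  refine (key m le_rfl).trans ?_
  simp only [Nat.add_sub_cancel] at hwrap
  have h3 : 0 ≤ ∫ x in (X (m + 1) m + δ / 2)..(X (m + 1) 0 - δ / 2 + 1), ψ x :=
    intervalIntegral.integral_nonneg (by linarith) fun x _ => hψ0 x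
  have h4 := hper.intervalIntegral_add_eq (X (m + 1) 0 - δ / 2) 0
  rw [zero_add] at h4
  have h5 := intervalIntegral.integral_add_adjacent_intervals
    (hψ (X (m + 1) 0 - δ / 2) (X (m + 1) m + δ / 2)) (hψ _ (X (m + 1) 0 - δ / 2 + 1))
  linarith

lemma ellp_local {p γ : ℝ} (hp : 1 ≤ p) (hγ : 0 < γ) {X : ℕ → ℕ → ℝ} (hX : NodesOK γ X)
    {n : ℕ} (hn : 1 ≤ n) {w v : ℝ → ℝ} (hw : MemLpT p w) {C δ : ℝ} (hC : 0 ≤ C) (hδ : δ = γ / n)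
    (hv : ∀ k, |v (X n k)| ≤ C * ((1 / δ) * ∫ x in (X n k - δ / 2)..(X n k - δ / 2 + δ), |w x|)) :
    ellp p n (X n) v ≤ C * (1 / γ) ^ (1 / p) * LpNorm p w := by
  have hn0 : (0:ℝ) < n := by exact_mod_cast hn
  have hδ0 : 0 < δ := by rw [hδ]; positivity
  have hp0 : 0 < p := by linarith
  have hI : 0 ≤ ∫ x in (0:ℝ)..1, |w x| ^ p :=
    intervalIntegral.integral_nonneg zero_le_one fun x _ => by positivity
  have h1 : (1 / (n:ℝ)) * ∑ k ∈ range n, |v (X n k)| ^ p ≤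
      C ^ p * ((1 / γ) * ∫ x in (0:ℝ)..1, |w x| ^ p) := by
    have : ∑ k ∈ range n, |v (X n k)| ^ p ≤ C ^ p * ((1 / δ) * ∫ x in (0:ℝ)..1, |w x| ^ p) := by
      calc _ ≤ ∑ k ∈ range n, C ^ p *
            ((1 / δ) * ∫ x in (X n k - δ / 2)..(X n k - δ / 2 + δ), |w x| ^ p) := by
            apply Finset.sum_le_sum
            intro k _
            have hnn : 0 ≤ (1 / δ) * ∫ x in (X n k - δ / 2)..(X n k - δ / 2 + δ), |w x| := by
              apply mul_nonneg (by positivity)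
              exact intervalIntegral.integral_nonneg (by linarith) fun x _ => abs_nonneg _
            calc _ ≤ _ := Real.rpow_le_rpow (abs_nonneg _) (hv k) hp0.le
              _ = _ := Real.mul_rpow hC hnn
              _ ≤ _ := mul_le_mul_of_nonneg_left (jensen_local hp hw _ δ hδ0) (by positivity)
        _ = C ^ p * ((1 / δ) * ∑ k ∈ range n,
              ∫ x in (X n k - δ / 2)..(X n k - δ / 2 + δ), |w x| ^ p) := by
            rw [Finset.mul_sum, Finset.mul_sum]
        _ ≤ _ := by
            apply mul_le_mul_of_nonneg_left _ (by positivity)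
            apply mul_le_mul_of_nonneg_left _ (by positivity)
            exact sum_intervals_le hX hn (fun x => by positivity) hw.intervalIntegrable_pow
              (fun x => by simp [hw.per x]) hδ
    calc _ ≤ (1 / (n:ℝ)) * (C ^ p * ((1 / δ) * ∫ x in (0:ℝ)..1, |w x| ^ p)) :=
          mul_le_mul_of_nonneg_left this (by positivity)
      _ = _ := by rw [hδ]; field_simp
  unfold ellp LpNorm
  calc _ ≤ (C ^ p * ((1 / γ) * ∫ x in (0:ℝ)..1, |w x| ^ p)) ^ (1 / p) := by
        apply Real.rpow_le_rpow _ h1 (by positivity)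
        apply mul_nonneg (by positivity)
        exact Finset.sum_nonneg fun k _ => by positivity
    _ = _ := by
        rw [Real.mul_rpow (by positivity) (by positivity), Real.mul_rpow (by positivity) hI,
          ← Real.rpow_mul hC, mul_one_div_cancel hp0.ne', Real.rpow_one]
        ring

lemma ellp_add_le {p : ℝ} (hp : 1 ≤ p) (n : ℕ) (x : ℕ → ℝ) (f g : ℝ → ℝ) :
    ellp p n x (fun t => f t + g t) ≤ ellp p n x f + ellp p n x g := by
  unfold ellp
  have h := Real.Lp_add_le (range n) (fun k => f (x k)) (fun k => g (x k)) hp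
  have s0 : ∀ u : ℝ → ℝ, 0 ≤ ∑ k ∈ range n, |u (x k)| ^ p := fun u =>
    Finset.sum_nonneg fun k _ => by positivity
  rw [Real.mul_rpow (by positivity) (s0 fun t => f t + g t), Real.mul_rpow (by positivity) (s0 f),
    Real.mul_rpow (by positivity) (s0 g), ← mul_add]
  exact mul_le_mul_of_nonneg_left h (by positivity)

lemma ellp_congr {p : ℝ} (n : ℕ) (x : ℕ → ℝ) (f g : ℝ → ℝ)
    (h : ∀ k < n, |f (x k)| = |g (x k)|) : ellp p n x f = ellp p n x g := by
  unfold ellp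
  congr 2
  apply Finset.sum_congr rfl
  intro k hk
  rw [h k (Finset.mem_range.1 hk)]

lemma ellp_nonneg {p : ℝ} (n : ℕ) (x : ℕ → ℝ) (f : ℝ → ℝ) : 0 ≤ ellp p n x f := by
  unfold ellp
  apply Real.rpow_nonneg
  apply mul_nonneg (by positivity)
  exact Finset.sum_nonneg fun k _ => by positivity

lemma steklov_ii {p : ℝ} (hp : 1 ≤ p) {f : ℝ → ℝ} (hf : MemLpT p f) (r : ℕ) (x a b : ℝ) (ν : ℕ) :
    IntervalIntegrable (fun t => (-1 : ℝ) ^ ν * (((2 * r).choose ν : ℝ)) *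
      f (x + (((r : ℝ) - (ν : ℝ)) / (r : ℝ)) * t)) volume a b :=
  (hf.ii_comp hp x _ a b).const_mul _

lemma steklov_sub {p : ℝ} (hp : 1 ≤ p) {f g : ℝ → ℝ} (hf : MemLpT p f) (hg : MemLpT p g)
    (r : ℕ) (δ x : ℝ) :
    steklov r δ (fun t => f t - g t) x = steklov r δ f x - steklov r δ g x := by
  unfold steklov
  rw [← mul_sub, ← intervalIntegral.integral_sub]
  · congr 2
    ext t
    rw [← Finset.sum_sub_distrib]
    apply Finset.sum_congr rfl
    intros; ring
  · have := IntervalIntegrable.sum (range r) (fun ν _ => steklov_ii hp hf r x (-(δ / 2)) (δ / 2) ν)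
    simpa only [Finset.sum_fn] using this
  · have := IntervalIntegrable.sum (range r) (fun ν _ => steklov_ii hp hg r x (-(δ / 2)) (δ / 2) ν)
    simpa only [Finset.sum_fn] using this

lemma steklov_abs_le {p : ℝ} (hp : 1 ≤ p) {f : ℝ → ℝ} (hf : MemLpT p f) {r : ℕ} (hr : 1 ≤ r)
    {δ : ℝ} (hδ : 0 < δ) (x : ℝ) :
    |steklov r δ f x| ≤ (2 * 2 ^ (2 * r) * r) *
      ((1 / δ) * ∫ y in (x - δ / 2)..(x - δ / 2 + δ), |f y|) := by
  set I := ∫ y in (x - δ / 2)..(x - δ / 2 + δ), |f y| with hI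
  have hI0 : 0 ≤ I := intervalIntegral.integral_nonneg (by linarith) fun x _ => abs_nonneg _
  have hr0 : (1:ℝ) ≤ r := by exact_mod_cast hr
  have hterm : ∀ ν ∈ range r, |∫ t in (-(δ / 2))..(δ / 2), (-1 : ℝ) ^ ν * (((2 * r).choose ν : ℝ)) *
      f (x + (((r : ℝ) - (ν : ℝ)) / (r : ℝ)) * t)| ≤ ((2 * r).choose ν : ℝ) * (r * I) := by
    intro ν hν
    have hν' : (ν:ℝ) + 1 ≤ r := by exact_mod_cast (Finset.mem_range.1 hν)
    set c : ℝ := ((r : ℝ) - (ν : ℝ)) / (r : ℝ) with hc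
    have hc0 : 0 < c := by rw [hc]; apply div_pos <;> linarith
    have hc1 : c ≤ 1 := by
      rw [hc, div_le_one (by linarith)]; have : (0:ℝ) ≤ ν := by positivity
      linarith
    have hcr : c⁻¹ ≤ r := by
      rw [hc, inv_div]
      apply div_le_self (by linarith); linarith
    rw [intervalIntegral.integral_const_mul, abs_mul]
    have e : |(-1 : ℝ) ^ ν * (((2 * r).choose ν : ℝ))| = ((2 * r).choose ν : ℝ) := by
      simp [abs_mul]
    rw [e]
    apply mul_le_mul_of_nonneg_left _ (by positivity)
    calc _ ≤ ∫ t in (-(δ / 2))..(δ / 2), |f (x + c * t)| :=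
          intervalIntegral.abs_integral_le_integral_abs (by linarith)
      _ = c⁻¹ * ∫ y in (x + c * (-(δ / 2)))..(x + c * (δ / 2)), |f y| := by
          rw [intervalIntegral.integral_comp_add_mul (fun y => |f y|) hc0.ne']; simp
      _ ≤ r * I := by
          apply mul_le_mul hcr _ _ (by linarith)
          · apply intervalIntegral.integral_mono_interval
            · nlinarith
            · nlinarith
            · nlinarith
            · exact ae_of_all _ fun y => abs_nonneg _
            · exact hf.abs_mem.intervalIntegrable hp _ _
          · exact intervalIntegral.integral_nonneg (by nlinarith) fun x _ => abs_nonneg _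
  unfold steklov
  rw [intervalIntegral.integral_finsetSum (fun ν _ => steklov_ii hp hf r x _ _ ν), abs_mul, abs_mul,
    abs_mul]
  have e1 : |(-1:ℝ) ^ (r + 1)| = 1 := by simp
  have e2 : |(((2 * r).choose r : ℝ))⁻¹| ≤ 1 := by
    rw [abs_of_nonneg (by positivity)]
    apply inv_le_one_of_one_le₀
    exact_mod_cast Nat.choose_pos (by omega)
  have e3 : |2 / δ| = 2 / δ := abs_of_pos (by positivity)
  have hsum : |∑ ν ∈ range r, ∫ t in (-(δ / 2))..(δ / 2), (-1 : ℝ) ^ ν * (((2 * r).choose ν : ℝ)) *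
      f (x + (((r : ℝ) - (ν : ℝ)) / (r : ℝ)) * t)| ≤ 2 ^ (2 * r) * (r * I) := by
    refine (Finset.abs_sum_le_sum_abs _ _).trans ((Finset.sum_le_sum hterm).trans ?_)
    rw [← Finset.sum_mul]
    apply mul_le_mul_of_nonneg_right _ (by positivity)
    have : ∑ ν ∈ range r, (2 * r).choose ν ≤ 2 ^ (2 * r) := by
      rw [← Nat.sum_range_choose]
      apply Finset.sum_le_sum_of_subset
      intro j hj; simp at hj ⊢; omega
    exact_mod_cast this
  rw [e1, e3, one_mul]
  calc _ ≤ 1 * (2 / δ) * (2 ^ (2 * r) * (r * I)) := by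
        apply mul_le_mul _ hsum (abs_nonneg _) (by positivity)
        exact mul_le_mul_of_nonneg_right e2 (by positivity)
    _ = _ := by ring

lemma between_mem {a b y h m c : ℝ} (h1 : y ∈ Set.Icc a b) (h2 : y + m * h ∈ Set.Icc a b)
    (hc0 : 0 ≤ c) (hcm : c ≤ m) : y + c * h ∈ Set.Icc a b := by
  obtain ⟨h1a, h1b⟩ := h1
  obtain ⟨h2a, h2b⟩ := h2
  rcases le_total 0 h with hh | hh
  · have := mul_le_mul_of_nonneg_right hcm hh
    have := mul_nonneg hc0 hh
    constructor <;> linarith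
  · have := mul_le_mul_of_nonpos_right hcm hh
    have := mul_nonpos_of_nonneg_of_nonpos hc0 hh
    constructor <;> linarith

lemma Delta_hasDerivAt {u : ℝ → ℝ} (hu : Differentiable ℝ u) (m : ℕ) (h x : ℝ) :
    HasDerivAt (Delta m h u) (Delta m h (deriv u) x) x := by
  unfold Delta
  apply HasDerivAt.fun_sum
  intro ν _
  apply HasDerivAt.const_mul
  exact (hu _).hasDerivAt.comp_add_const x _

lemma Delta_local (k : ℕ) : ∀ {u : ℝ → ℝ}, ContDiff ℝ (k + 1 : ℕ) u → ∀ {a b y h : ℝ},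
    y ∈ Set.Icc a b → y + (k + 1 : ℕ) * h ∈ Set.Icc a b →
    |Delta (k + 1) h u y| ≤ |h| ^ k * ∫ x in a..b, |iteratedDeriv (k + 1) u x| := by
  induction k with
  | zero =>
    intro u hu a b y h hy hyh
    simp only [zero_add, Nat.cast_one, one_mul] at hyh hu
    have hd : Continuous (deriv u) := hu.continuous_deriv (by simp)
    have hab : a ≤ b := hy.1.trans hy.2
    rw [Delta_succ, Delta_zero]
    simp only [pow_zero, one_mul, zero_add, iteratedDeriv_one]
    rw [← intervalIntegral.integral_deriv_eq_sub (fun x _ => hu.differentiable (by simp) x)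
      (hd.intervalIntegrable _ _)]
    rw [← Real.norm_eq_abs]
    refine (intervalIntegral.norm_integral_le_integral_norm_uIoc).trans ?_
    rw [intervalIntegral.integral_of_le hab]
    apply setIntegral_mono_set
    · exact (hd.abs.integrableOn_Icc (a := a) (b := b)).mono_set Set.Ioc_subset_Icc_self
    · exact ae_of_all _ fun x => abs_nonneg _
    · apply LE.le.eventuallyLE
      unfold Set.uIoc
      apply Set.Ioc_subset_Ioc
      · exact le_min hy.1 hyh.1
      · exact max_le hy.2 hyh.2
  | succ k ih =>
    intro u hu a b y h hy hyh
    have hu' : ContDiff ℝ ((k + 1 : ℕ) + 1) u := by exact_mod_cast hu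
    obtain ⟨hdiff, -, hder⟩ := contDiff_succ_iff_deriv.1 hu'
    have hab : a ≤ b := hy.1.trans hy.2
    rw [Delta_succ]
    have key : ∀ z ∈ Set.uIcc y (y + h), ‖Delta (k + 1) h (deriv u) z‖ ≤
        |h| ^ k * ∫ x in a..b, |iteratedDeriv (k + 1 + 1) u x| := by
      intro z hz
      rw [Real.norm_eq_abs, iteratedDeriv_succ']
      have m1 : y + h ∈ Set.Icc a b := by
        have := between_mem (c := 1) hy hyh zero_le_one (by push_cast; linarith [k.cast_nonneg (α := ℝ)])
        simpa using this
      have m2 : y + (k + 1 : ℕ) * h ∈ Set.Icc a b :=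
        between_mem hy hyh (by positivity) (by push_cast; linarith)
      have e : y + h + (k + 1 : ℕ) * h ∈ Set.Icc a b := by
        convert hyh using 1; push_cast; ring
      have conv : Convex ℝ (Set.Icc a b) := convex_Icc a b
      rw [← segment_eq_uIcc] at hz
      apply ih hder
      · exact conv.segment_subset hy m1 hz
      · apply conv.segment_subset m2 e
        have := (mem_segment_translate ℝ (((k + 1 : ℕ):ℝ) * h)).2 hz
        simpa [add_comm, add_left_comm] using this
    have := (convex_uIcc y (y + h)).norm_image_sub_le_of_norm_hasDerivWithin_le
      (fun z _ => (Delta_hasDerivAt hdiff (k + 1) h z).hasDerivWithinAt) key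
      Set.left_mem_uIcc Set.right_mem_uIcc
    rw [Real.norm_eq_abs] at this
    refine this.trans (le_of_eq ?_)
    simp only [add_sub_cancel_left, Real.norm_eq_abs]
    ring

lemma Delta_local' (k d : ℕ) {u : ℝ → ℝ} (hu : ContDiff ℝ (k + 1 : ℕ) u) {a b h : ℝ} :
    ∀ {y : ℝ}, y ∈ Set.Icc a b → y + (k + 1 + d : ℕ) * h ∈ Set.Icc a b →
    |Delta (k + 1 + d) h u y| ≤ 2 ^ d * (|h| ^ k * ∫ x in a..b, |iteratedDeriv (k + 1) u x|) := by
  induction d with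
  | zero => intro y hy hyh; simpa using Delta_local k hu hy hyh
  | succ d ih =>
    intro y hy hyh
    rw [← add_assoc, Delta_succ]
    have m1 : y + h ∈ Set.Icc a b := by
      have := between_mem (c := 1) hy hyh zero_le_one (by
        push_cast; linarith [k.cast_nonneg (α := ℝ), d.cast_nonneg (α := ℝ)])
      simpa using this
    have m2 : y + (k + 1 + d : ℕ) * h ∈ Set.Icc a b :=
      between_mem hy hyh (by positivity) (by push_cast; linarith)
    have m3 : y + h + (k + 1 + d : ℕ) * h ∈ Set.Icc a b := by
      convert hyh using 1; push_cast; ring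
    calc _ ≤ |Delta (k + 1 + d) h u (y + h)| + |Delta (k + 1 + d) h u y| := abs_sub _ _
      _ ≤ _ := add_le_add (ih m1 m3) (ih hy m2)
      _ = _ := by ring

lemma steklov_sub_eq {g : ℝ → ℝ} (hg : Continuous g) {r : ℕ} (hr : 1 ≤ r) {δ : ℝ} (hδ : 0 < δ)
    (x : ℝ) : steklov r δ g x - g x = (-1 : ℝ) ^ (r + 1) * (((2 * r).choose r : ℝ))⁻¹ *
      ((1 / δ) * ∫ t in (-(δ / 2))..(δ / 2), Delta (2 * r) (t / r) g (x - t)) := by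
  have hr0 : (r:ℝ) ≠ 0 := by positivity
  set a : ℕ → ℝ → ℝ := fun ν t => (-1 : ℝ) ^ ν * (((2 * r).choose ν : ℝ)) *
    g (x + (((r : ℝ) - (ν : ℝ)) / (r : ℝ)) * t) with ha
  have hac : ∀ ν, Continuous (a ν) := fun ν => by
    simp only [ha]; exact continuous_const.mul (hg.comp (by fun_prop))
  have e1 : ∀ t, Delta (2 * r) (t / r) g (x - t) =
      (∑ ν ∈ range r, a ν t) + ((-1) ^ r * ((2 * r).choose r : ℝ) * g x +
        ∑ ν ∈ range r, a ν (-t)) := by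
    intro t
    have e : Delta (2 * r) (t / r) g (x - t) = ∑ ν ∈ range (2 * r + 1), a ν t := by
      unfold Delta
      apply Finset.sum_congr rfl
      intro ν _
      simp only [ha]
      congr 2
      push_cast
      field_simp
      ring
    have e' : 2 * r + 1 = r + (r + 1) := by omega
    rw [e, e', Finset.sum_range_add, Finset.sum_range_succ']
    congr 1
    rw [add_comm]
    congr 1
    · simp [ha]
    · rw [← Finset.sum_range_reflect]
      apply Finset.sum_congr rfl
      intro j hj
      have hj' : j < r := Finset.mem_range.1 hj
      have e2 : r + (r - 1 - j + 1) = 2 * r - j := by omega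
      simp only [ha]
      rw [e2, Nat.choose_symm (by omega), Nat.cast_sub (by omega)]
      have e3 : (-1:ℝ) ^ (2 * r - j) = (-1) ^ j := by
        have : (-1:ℝ) ^ (2 * r - j) * ((-1) ^ j * (-1) ^ j) = (-1) ^ j := by
          rw [← mul_assoc, ← pow_add, Nat.sub_add_cancel (by omega), pow_mul]; simp
        rwa [← mul_pow, neg_one_mul, neg_neg, one_pow, mul_one] at this
      rw [e3]
      congr 2
      push_cast
      field_simp
      ring
  have hs : Continuous fun t => ∑ ν ∈ range r, a ν t := continuous_finsetSum _ fun ν _ => hac ν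
  have hs' : Continuous fun t => ∑ ν ∈ range r, a ν (-t) := hs.comp continuous_neg
  have hs'' : Continuous fun t => (-1) ^ r * ((2 * r).choose r : ℝ) * g x +
      ∑ ν ∈ range r, a ν (-t) := continuous_const.add hs'
  have e4 : ∫ t in (-(δ / 2))..(δ / 2), Delta (2 * r) (t / r) g (x - t) =
      2 * (∫ t in (-(δ / 2))..(δ / 2), ∑ ν ∈ range r, a ν t) +
        δ * ((-1) ^ r * ((2 * r).choose r : ℝ) * g x) := by
    simp_rw [e1]
    rw [intervalIntegral.integral_add (hs.intervalIntegrable _ _)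
      (hs''.intervalIntegrable _ _),
      intervalIntegral.integral_add (continuous_const.intervalIntegrable _ _)
      (hs'.intervalIntegrable _ _),
      intervalIntegral.integral_comp_neg (fun t => ∑ ν ∈ range r, a ν t)]
    simp
    ring
  rw [e4]
  unfold steklov
  have hch : ((2 * r).choose r : ℝ) ≠ 0 := by
    have := Nat.choose_pos (show r ≤ 2 * r by omega)
    positivity
  have hsg : (-1:ℝ) ^ r * (-1) ^ r = 1 := by rw [← mul_pow]; simp
  rw [pow_succ]
  simp only [ha]
  field_simp
  linear_combination (δ * ((2 * r).choose r : ℝ) * g x) * hsg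

lemma steklov_smooth_abs_le {s : ℕ} (hs : 1 ≤ s) {g : ℝ → ℝ} (hg : ContDiff ℝ s g) {r : ℕ}
    (hr : 1 ≤ r) (hsr : s ≤ 2 * r) {δ : ℝ} (hδ : 0 < δ) (x : ℝ) :
    |steklov r δ g x - g x| ≤ (2 ^ (2 * r) * δ ^ s) *
      ((1 / δ) * ∫ y in (x - δ / 2)..(x - δ / 2 + δ), |iteratedDeriv s g y|) := by
  obtain ⟨k, rfl⟩ := Nat.exists_eq_add_of_le' hs
  obtain ⟨d, hd⟩ := Nat.exists_eq_add_of_le hsr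
  have hr1 : (1:ℝ) ≤ r := by exact_mod_cast hr
  set I := ∫ y in (x - δ / 2)..(x - δ / 2 + δ), |iteratedDeriv (k + 1) g y| with hI
  have hI0 : 0 ≤ I := intervalIntegral.integral_nonneg (by linarith) fun x _ => abs_nonneg _
  rw [steklov_sub_eq hg.continuous hr hδ, abs_mul, abs_mul, abs_mul]
  have e1 : |(-1:ℝ) ^ (r + 1)| = 1 := by simp
  have e2 : |(((2 * r).choose r : ℝ))⁻¹| ≤ 1 := by
    rw [abs_of_nonneg (by positivity)]
    apply inv_le_one_of_one_le₀
    exact_mod_cast Nat.choose_pos (by omega)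
  have e3 : |1 / δ| = 1 / δ := abs_of_pos (by positivity)
  have key : ∀ t ∈ Set.uIoc (-(δ / 2)) (δ / 2), ‖Delta (2 * r) (t / r) g (x - t)‖ ≤
      2 ^ (2 * r) * (δ ^ k * I) := by
    intro t ht
    rw [Set.uIoc_of_le (by linarith)] at ht
    have h1 : |Delta (2 * r) (t / r) g (x - t)| ≤ 2 ^ d * (|t / r| ^ k * I) := by
      rw [hd]
      apply Delta_local' k d hg
      · constructor <;> linarith [ht.1, ht.2]
      · rw [← hd]
        have : x - t + ((2 * r : ℕ) : ℝ) * (t / r) = x + t := by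
          push_cast; field_simp; ring
        rw [this]
        constructor <;> linarith [ht.1, ht.2]
    rw [Real.norm_eq_abs]
    refine h1.trans ?_
    have h2 : |t / r| ≤ δ := by
      rw [abs_div, abs_of_pos (by linarith : (0:ℝ) < r)]
      refine (div_le_self (abs_nonneg _) hr1).trans ?_
      rw [abs_le]; constructor <;> linarith [ht.1, ht.2]
    apply mul_le_mul
    · exact pow_le_pow_right₀ (by norm_num) (by omega)
    · exact mul_le_mul_of_nonneg_right (pow_le_pow_left₀ (abs_nonneg _) h2 k) hI0
    · positivity
    · positivity
  have h3 := intervalIntegral.norm_integral_le_of_norm_le_const key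
  have e5 : |δ / 2 - -(δ / 2)| = δ := by rw [abs_of_pos] <;> linarith
  rw [e5, Real.norm_eq_abs] at h3
  rw [e1, e3, one_mul]
  calc _ ≤ 1 * ((1 / δ) * (2 ^ (2 * r) * (δ ^ k * I) * δ)) := by
        apply mul_le_mul e2 _ (by positivity) zero_le_one
        exact mul_le_mul_of_nonneg_left h3 (by positivity)
    _ = _ := by rw [pow_succ]; ring

/-- discrete bound for the Steklov operator -/
lemma ellp_steklov_le {p γ : ℝ} (hp : 1 ≤ p) (hγ : 0 < γ) {X : ℕ → ℕ → ℝ} (hX : NodesOK γ X)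
    {n : ℕ} (hn : 1 ≤ n) {r : ℕ} (hr : 1 ≤ r) {w : ℝ → ℝ} (hw : MemLpT p w) :
    ellp p n (X n) (steklov r (γ / n) w) ≤
      (2 * 2 ^ (2 * r) * r) * (1 / γ) ^ (1 / p) * LpNorm p w := by
  have hn0 : (0:ℝ) < n := by exact_mod_cast hn
  exact ellp_local hp hγ hX hn hw (by positivity) rfl
    fun k => steklov_abs_le hp hw hr (by positivity) _

lemma ellp_steklov_smooth_le {p γ : ℝ} (hp : 1 ≤ p) (hγ : 0 < γ) (hγ1 : γ ≤ 1) {X : ℕ → ℕ → ℝ}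
    (hX : NodesOK γ X) {n : ℕ} (hn : 1 ≤ n) {r s : ℕ} (hr : 1 ≤ r) (hs : 1 ≤ s) (hsr : s ≤ 2 * r)
    {g : ℝ → ℝ} (hg : SobolevW s g) :
    ellp p n (X n) (fun x => steklov r (γ / n) g x - g x) ≤
      2 ^ (2 * r) * (1 / γ) ^ (1 / p) * ((1 / (n:ℝ) ^ s) * LpNorm p (iteratedDeriv s g)) := by
  have hn0 : (0:ℝ) < n := by exact_mod_cast hn
  have h1 := ellp_local (v := fun x => steklov r (γ / n) g x - g x) hp hγ hX hn (hg.mem_deriv hp)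
    (C := 2 ^ (2 * r) * (γ / n) ^ s) (by positivity) rfl
    fun k => steklov_smooth_abs_le hs hg.2 hr hsr (by positivity) _
  refine h1.trans ?_
  have h2 : (γ / n) ^ s ≤ 1 / (n:ℝ) ^ s := by
    rw [div_pow]
    gcongr
    exact pow_le_one₀ hγ.le hγ1
  have h3 := LpNorm_nonneg p (iteratedDeriv s g)
  calc _ = 2 ^ (2 * r) * (1 / γ) ^ (1 / p) * ((γ / n) ^ s * LpNorm p (iteratedDeriv s g)) := by ring
    _ ≤ _ := by gcongr

lemma seq_telescope {E : ℕ → ℝ} {α D : ℝ} (hα : 0 < α) (hE : Tendsto E atTop (nhds 0)) (hD : 0 < D)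
    (h : ∀ n : ℕ, 1 ≤ n → E n ≤ E (2 * n) + D * (n:ℝ) ^ (-α)) :
    ∃ C : ℝ, 0 < C ∧ ∀ n : ℕ, 1 ≤ n → E n ≤ C * (n:ℝ) ^ (-α) := by
  set q : ℝ := (2:ℝ) ^ (-α) with hq
  have hq0 : 0 < q := by positivity
  have hq1 : q < 1 := Real.rpow_lt_one_of_one_lt_of_neg (by norm_num) (by linarith)
  have hB : 0 < D / (1 - q) := div_pos hD (by linarith)
  refine ⟨D / (1 - q), hB, fun n hn => ?_⟩
  set B := D / (1 - q) with hBd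
  have hBD : B * (1 - q) = D := by rw [hBd]; field_simp [show (1 - q) ≠ 0 by linarith]
  have hn0 : (0:ℝ) < n := by exact_mod_cast hn
  set u : ℝ := (n:ℝ) ^ (-α) with hu
  have hu0 : 0 < u := by positivity
  have key : ∀ m : ℕ, E n ≤ E (2 ^ m * n) + B * u - B * q ^ m * u := by
    intro m
    induction m with
    | zero => simp
    | succ m ih =>
      have h1 := h (2 ^ m * n) (Nat.one_le_iff_ne_zero.2 (by positivity))
      have e : (((2 ^ m * n : ℕ)) : ℝ) ^ (-α) = q ^ m * u := by
        push_cast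
        rw [Real.mul_rpow (by positivity) hn0.le, hq, ← Real.rpow_natCast, ← Real.rpow_natCast,
          ← Real.rpow_mul (by norm_num), ← Real.rpow_mul (by norm_num), mul_comm (m:ℝ)]
      have e2 : 2 * (2 ^ m * n) = 2 ^ (m + 1) * n := by ring
      rw [e, e2, ← hBD] at h1
      rw [pow_succ q]
      linarith
  have ht : Tendsto (fun m : ℕ => E (2 ^ m * n) + B * u) atTop (nhds (0 + B * u)) := by
    refine Tendsto.add (hE.comp ?_) tendsto_const_nhds
    exact Tendsto.atTop_mul_const' (by omega) (tendsto_pow_atTop_atTop_of_one_lt (by norm_num))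
  have := ge_of_tendsto' ht (fun m => show E n ≤ E (2 ^ m * n) + B * u by
    have := key m
    have : 0 ≤ B * q ^ m * u := by positivity
    linarith)
  linarith

lemma seq_induct {E A : ℕ → ℝ} {α C K K' : ℝ} {s : ℕ} (hα : 0 < α) (hαs : α < s)
    (hA : ∀ n, 0 ≤ A n) (hC : 0 < C) (hK : 0 < K) (hK' : 0 < K')
    (hE : ∀ n : ℕ, 1 ≤ n → E n ≤ C * (n:ℝ) ^ (-α))
    (h : ∀ n N : ℕ, 1 ≤ n → 1 ≤ N → (1 / (N:ℝ) ^ s) * A N ≤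
      K * (E N + E n) + K' * ((1 / (N:ℝ) ^ s) * A n)) :
    ∃ C : ℝ, 0 < C ∧ ∀ n : ℕ, 1 ≤ n → A n ≤ C * (n:ℝ) ^ ((s:ℝ) - α) := by
  have hβ : 0 < (s:ℝ) - α := by linarith
  obtain ⟨M, hM⟩ : ∃ M : ℕ, 1 ≤ M ∧ 2 * K' ≤ (M:ℝ) ^ ((s:ℝ) - α) := by
    have h1 := ((tendsto_rpow_atTop hβ).comp tendsto_natCast_atTop_atTop).eventually_ge_atTop (2 * K')
    obtain ⟨M, h2, h3⟩ := (h1.and (eventually_ge_atTop 1)).exists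
    exact ⟨M, h3, h2⟩
  obtain ⟨hM1, hM2⟩ := hM
  have hM0 : (0:ℝ) < M := by exact_mod_cast hM1
  set S := ∑ k ∈ range M, A k with hS
  have hS0 : 0 ≤ S := Finset.sum_nonneg fun k _ => hA k
  set T : ℝ := K * C * (1 + (2 * (M:ℝ)) ^ α) with hT
  have hT0 : 0 < T := by positivity
  refine ⟨2 * T + S, by positivity, ?_⟩
  intro N
  induction N using Nat.strong_induction_on with
  | _ N ih =>
  intro hN
  have hN0 : (0:ℝ) < N := by exact_mod_cast hN
  have hN1 : (1:ℝ) ≤ N := by exact_mod_cast hN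
  rcases lt_or_ge N M with hNM | hNM
  · have h1 : A N ≤ S := Finset.single_le_sum (f := A) (fun k _ => hA k) (Finset.mem_range.2 hNM)
    have h2 : (1:ℝ) ≤ (N:ℝ) ^ ((s:ℝ) - α) := Real.one_le_rpow hN1 hβ.le
    nlinarith
  · rcases Nat.lt_or_ge 1 M with hM3 | hM3
    swap
    · have hMe : M = 1 := by omega
      have h2 := h N N hN hN
      have h3 : K' ≤ 1 / 2 := by
        rw [hMe] at hM2; simp at hM2; linarith
      have h4 : (1 / (N:ℝ) ^ s) * A N ≤ 4 * K * (C * (N:ℝ) ^ (-α)) := by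
        have h5 : 0 ≤ (1 / (N:ℝ) ^ s) * A N := mul_nonneg (by positivity) (hA N)
        have h6 := hE N hN
        have h7 : K * (E N + E N) ≤ 2 * K * (C * (N:ℝ) ^ (-α)) := by nlinarith
        nlinarith
      have h8 : A N ≤ 4 * K * C * (N:ℝ) ^ ((s:ℝ) - α) := by
        rw [sub_eq_add_neg, Real.rpow_add hN0, Real.rpow_natCast]
        rw [one_div, inv_mul_le_iff₀ (by positivity)] at h4
        linarith
      have h9 : 2 * T ≥ 4 * K * C := by
        have : (1:ℝ) ≤ (2 * (M:ℝ)) ^ α := Real.one_le_rpow (by rw [hMe]; norm_num) hα.le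
        have hKC : 0 < K * C := by positivity
        rw [hT]; nlinarith
      have h10 : 0 < (N:ℝ) ^ ((s:ℝ) - α) := by positivity
      nlinarith
    set n := N / M with hn
    have hn1 : 1 ≤ n := (Nat.one_le_div_iff (by omega)).2 hNM
    have hnN : n < N := Nat.div_lt_self (by omega) hM3
    have hn0 : (0:ℝ) < n := by exact_mod_cast hn1
    have hnM : (n:ℝ) * M ≤ N := by exact_mod_cast Nat.div_mul_le_self N M
    have hNn : (N:ℝ) ≤ 2 * M * n := by
      have h1 : N < M * (n + 1) := Nat.lt_mul_div_succ N (by omega)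
      have h2 : M * (n + 1) ≤ 2 * M * n := by nlinarith
      exact_mod_cast h1.le.trans h2
    have hA1 := ih n hnN hn1
    have hmain := h n N hn1 hN
    have e1 := hE N hN
    have e2 : E n ≤ C * ((2 * (M:ℝ)) ^ α * (N:ℝ) ^ (-α)) := by
      refine (hE n hn1).trans (mul_le_mul_of_nonneg_left ?_ hC.le)
      rw [Real.rpow_neg hn0.le, Real.rpow_neg hN0.le, ← div_eq_mul_inv, inv_eq_one_div,
        div_le_div_iff₀ (by positivity) (by positivity), one_mul,
        ← Real.mul_rpow (by positivity) hn0.le]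
      exact Real.rpow_le_rpow hN0.le hNn hα.le
    have e3 : K' * (n:ℝ) ^ ((s:ℝ) - α) ≤ 1 / 2 * (N:ℝ) ^ ((s:ℝ) - α) := by
      have h1 : (n:ℝ) ^ ((s:ℝ) - α) * (M:ℝ) ^ ((s:ℝ) - α) ≤ (N:ℝ) ^ ((s:ℝ) - α) := by
        rw [← Real.mul_rpow hn0.le hM0.le]
        exact Real.rpow_le_rpow (by positivity) hnM hβ.le
      have h2 : 0 < (n:ℝ) ^ ((s:ℝ) - α) := by positivity
      nlinarith
    have e4 : (1 / (N:ℝ) ^ s) * A N ≤ T * (N:ℝ) ^ (-α) + K' * ((1 / (N:ℝ) ^ s) * A n) := by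
      refine hmain.trans (add_le_add_left ?_ _)
      calc K * (E N + E n) ≤ K * (C * (N:ℝ) ^ (-α) + C * ((2 * (M:ℝ)) ^ α * (N:ℝ) ^ (-α))) :=
            mul_le_mul_of_nonneg_left (add_le_add e1 e2) hK.le
        _ = T * (N:ℝ) ^ (-α) := by rw [hT]; ring
    have e5 : A N ≤ T * (N:ℝ) ^ ((s:ℝ) - α) + K' * A n := by
      have hs0 : (0:ℝ) < (N:ℝ) ^ s := by positivity
      have := mul_le_mul_of_nonneg_left e4 hs0.le
      have c1 : (N:ℝ) ^ s * ((1 / (N:ℝ) ^ s) * A N) = A N := by field_simp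
      have c2 : (N:ℝ) ^ s * (T * (N:ℝ) ^ (-α) + K' * ((1 / (N:ℝ) ^ s) * A n)) =
          T * ((N:ℝ) ^ s * (N:ℝ) ^ (-α)) + K' * A n := by field_simp
      rw [c1, c2] at this
      rw [sub_eq_add_neg, Real.rpow_add hN0, Real.rpow_natCast]
      exact this
    have e6 : K' * A n ≤ (2 * T + S) * (1 / 2 * (N:ℝ) ^ ((s:ℝ) - α)) := by
      calc K' * A n ≤ K' * ((2 * T + S) * (n:ℝ) ^ ((s:ℝ) - α)) :=
            mul_le_mul_of_nonneg_left hA1 hK'.le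
        _ = (2 * T + S) * (K' * (n:ℝ) ^ ((s:ℝ) - α)) := by ring
        _ ≤ _ := mul_le_mul_of_nonneg_left e3 (by positivity)
    have h10 : 0 < (N:ℝ) ^ ((s:ℝ) - α) := by positivity
    nlinarith

lemma npow_neg_mul {n s : ℕ} (hn : 1 ≤ n) {α A C : ℝ} (h : A ≤ C * (n:ℝ) ^ ((s:ℝ) - α)) :
    (1 / (n:ℝ) ^ s) * A ≤ C * (n:ℝ) ^ (-α) := by
  have hn0 : (0:ℝ) < n := by exact_mod_cast hn
  rw [sub_eq_add_neg, Real.rpow_add hn0, Real.rpow_natCast] at h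
  rw [one_div, inv_mul_le_iff₀ (by positivity)]
  linarith

theorem stmt14 (p γ : ℝ) (r s : ℕ) (X : ℕ → ℕ → ℝ) (φ : ℕ → ℕ → ℝ → ℝ)
    (G : ℕ → (ℝ → ℝ) → ℝ → ℝ)
    (hp : 1 ≤ p) (hr : 1 ≤ r) (hs : 1 ≤ s) (hsr : s ≤ 2 * r)
    (hγ0 : 0 < γ) (hγ1 : γ ≤ 1) (hX : NodesOK γ X) (hGform : SamplingForm p X φ G)
    (K1 : ℝ) (hK1 : 0 < K1) (hc1 : CondC1 p K1 X G) (K2 : ℝ) (hK2 : 0 < K2) (hc1' : CondC1' p K2 X G) (K3 : ℝ) (hK3 : 0 < K3) (hc2' : CondC2' p K3 s G) (K5 : ℝ) (hK5 : 0 < K5) (hc3 : CondC3 p K5 s G)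
    (α : ℝ) (hα0 : 0 < α) (hαs : α < (s : ℝ))
    (f : ℝ → ℝ) (hf : MemLpT p f)
    (hconv : Filter.Tendsto (fun k : ℕ => LpNorm p (fun x => f x - G k f x))
      Filter.atTop (nhds 0))
    (hinterp : ∀ n : ℕ, 1 ≤ n → ∀ k, k < n → G n f (X n k) = f (X n k))
    (hnest : ∀ n : ℕ, 1 ≤ n → ∀ k, k < n → ∃ j, j < 2 * n ∧ X (2 * n) j = X n k) :
    ((∃ C : ℝ, 0 < C ∧ ∀ n : ℕ, 1 ≤ n →
        LpNorm p (fun x => f x - G n f x) ≤ C * (n : ℝ) ^ (-α)) ↔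
      (∃ C : ℝ, 0 < C ∧ ∀ n : ℕ, 1 ≤ n →
        ellp p n (X n) (fun x => steklov r (γ / (n : ℝ)) f x - f x) + omegaMod s p f (1 / (n : ℝ)) ≤ C * (n : ℝ) ^ (-α))) ∧
    ((∃ C : ℝ, 0 < C ∧ ∀ n : ℕ, 1 ≤ n →
        ellp p n (X n) (fun x => steklov r (γ / (n : ℝ)) f x - f x) + omegaMod s p f (1 / (n : ℝ)) ≤ C * (n : ℝ) ^ (-α)) ↔
      (∃ C : ℝ, 0 < C ∧ ∀ n : ℕ, 1 ≤ n →
        LpNorm p (iteratedDeriv s (G n f)) ≤ C * (n : ℝ) ^ ((s : ℝ) - α))) := by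
  have hG : ∀ n, 1 ≤ n → SobolevW s (G n f) := fun n hn => (hc3 f hf n hn).1
  have hGm : ∀ n, 1 ≤ n → MemLpT p (G n f) := fun n hn => (hG n hn).mem hp
  have hγp : 0 < (1 / γ) ^ (1 / p) := by positivity
  -- (iii) implies (i)
  have h31 : (∃ C : ℝ, 0 < C ∧ ∀ n : ℕ, 1 ≤ n →
        LpNorm p (iteratedDeriv s (G n f)) ≤ C * (n : ℝ) ^ ((s : ℝ) - α)) →
      (∃ C : ℝ, 0 < C ∧ ∀ n : ℕ, 1 ≤ n →
        LpNorm p (fun x => f x - G n f x) ≤ C * (n : ℝ) ^ (-α)) := by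
    rintro ⟨C, hC, hb⟩
    refine seq_telescope (E := fun n => LpNorm p (fun x => f x - G n f x))
      (D := K3 * (C * 2 ^ ((s:ℝ) - α))) hα0 hconv (by positivity) ?_
    intro n hn
    have hn0 : (0:ℝ) < n := by exact_mod_cast hn
    have h2n : 1 ≤ 2 * n := by omega
    have e : G n (G (2 * n) f) = G n f := by
      ext x
      rw [hGform.2, hGform.2]
      apply Finset.sum_congr rfl
      intro k hk
      obtain ⟨j, hj, hjk⟩ := hnest n hn k (Finset.mem_range.1 hk)
      have := hinterp (2 * n) h2n j hj
      rw [hjk] at this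
      rw [this]
    have h1 := hc2' _ (hG _ h2n) n hn
    rw [e] at h1
    have h2 := hb (2 * n) h2n
    have h3 : LpNorm p (iteratedDeriv s (G (2 * n) f)) ≤
        (C * 2 ^ ((s:ℝ) - α)) * (n:ℝ) ^ ((s:ℝ) - α) := by
      refine h2.trans (le_of_eq ?_)
      push_cast
      rw [Real.mul_rpow (by norm_num) hn0.le]; ring
    have h4 := npow_neg_mul hn h3
    have h5 := LpNorm_add_le hp (hf.sub hp (hGm _ h2n)) ((hGm _ h2n).sub hp (hGm n hn))
    have e5 : (fun x => f x - G (2 * n) f x + (G (2 * n) f x - G n f x)) =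
        fun x => f x - G n f x := by ext x; ring
    rw [e5] at h5
    have h6 : K3 / (n:ℝ) ^ s * LpNorm p (iteratedDeriv s (G (2 * n) f)) =
        K3 * (1 / (n:ℝ) ^ s * LpNorm p (iteratedDeriv s (G (2 * n) f))) := by ring
    rw [h6] at h1
    have h7 := mul_le_mul_of_nonneg_left h4 hK3.le
    linarith
  -- (i) implies (iii)
  have h13 : (∃ C : ℝ, 0 < C ∧ ∀ n : ℕ, 1 ≤ n →
        LpNorm p (fun x => f x - G n f x) ≤ C * (n : ℝ) ^ (-α)) →
      (∃ C : ℝ, 0 < C ∧ ∀ n : ℕ, 1 ≤ n →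
        LpNorm p (iteratedDeriv s (G n f)) ≤ C * (n : ℝ) ^ ((s : ℝ) - α)) := by
    rintro ⟨C, hC, hb⟩
    refine seq_induct (E := fun n => LpNorm p (fun x => f x - G n f x))
      (A := fun n => LpNorm p (iteratedDeriv s (G n f))) (K := K5 * 2 ^ s) (K' := K5)
      hα0 hαs (fun n => LpNorm_nonneg _ _) hC (by positivity) hK5 hb ?_
    intro n N hn hN
    have hN0 : (0:ℝ) < N := by exact_mod_cast hN
    have h1 := (hc3 f hf N hN).2
    have h2 := omega_le_add hp (hGm N hN) (hGm n hn) s (1 / (N:ℝ))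
    have h3 := omega_le_deriv hp (δ := 1 / (N:ℝ)) (by positivity) s (hG n hn)
    rw [one_div_pow] at h3
    have h4 := LpNorm_sub_le hp (hf.sub hp (hGm n hn)) (hf.sub hp (hGm N hN))
    have e4 : (fun x => f x - G n f x - (f x - G N f x)) = fun x => G N f x - G n f x := by
      ext x; ring
    rw [e4] at h4
    have h5 := mul_le_mul_of_nonneg_left h4 (show (0:ℝ) ≤ 2 ^ s by positivity)
    have h6 := mul_le_mul_of_nonneg_left (h2.trans (add_le_add h5 h3)) hK5.le
    linarith
  -- (i) and (iii) imply (ii)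
  have h132 : (∃ C : ℝ, 0 < C ∧ ∀ n : ℕ, 1 ≤ n →
        LpNorm p (fun x => f x - G n f x) ≤ C * (n : ℝ) ^ (-α)) →
      (∃ C : ℝ, 0 < C ∧ ∀ n : ℕ, 1 ≤ n →
        LpNorm p (iteratedDeriv s (G n f)) ≤ C * (n : ℝ) ^ ((s : ℝ) - α)) →
      (∃ C : ℝ, 0 < C ∧ ∀ n : ℕ, 1 ≤ n →
        ellp p n (X n) (fun x => steklov r (γ / (n : ℝ)) f x - f x) +
          omegaMod s p f (1 / (n : ℝ)) ≤ C * (n : ℝ) ^ (-α)) := by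
    rintro ⟨C, hC, hb⟩ ⟨C', hC', hb'⟩
    have hr0 : (0:ℝ) < r := by exact_mod_cast hr
    refine ⟨(2 * 2 ^ (2 * r) * r) * (1 / γ) ^ (1 / p) * C + 2 ^ (2 * r) * (1 / γ) ^ (1 / p) * C' +
      (2 ^ s * C + C'), by positivity, ?_⟩
    intro n hn
    have hn0 : (0:ℝ) < n := by exact_mod_cast hn
    have hE := hb n hn
    have hA := npow_neg_mul hn (hb' n hn)
    have h2 := omega_le_add hp hf (hGm n hn) s (1 / (n:ℝ))
    have h3 := omega_le_deriv hp (δ := 1 / (n:ℝ)) (by positivity) s (hG n hn)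
    rw [one_div_pow] at h3
    have h4 := ellp_steklov_le hp hγ0 hX hn hr (hf.sub hp (hGm n hn))
    have h5 := ellp_steklov_smooth_le hp hγ0 hγ1 hX hn hr hs hsr (hG n hn)
    have h6 := ellp_add_le hp n (X n) (steklov r (γ / n) (fun x => f x - G n f x))
      (fun x => steklov r (γ / n) (G n f) x - G n f x)
    have h7 : ellp p n (X n) (fun x => steklov r (γ / (n : ℝ)) f x - f x) =
        ellp p n (X n) (fun x => steklov r (γ / n) (fun x => f x - G n f x) x +
          (steklov r (γ / n) (G n f) x - G n f x)) := by
      apply ellp_congr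
      intro k hk
      rw [steklov_sub hp hf (hGm n hn), hinterp n hn k hk]
      congr 1; ring
    rw [h7]
    have m1 := mul_le_mul_of_nonneg_left hE
      (show 0 ≤ (2 * 2 ^ (2 * r) * r) * (1 / γ) ^ (1 / p) by positivity)
    have m2 := mul_le_mul_of_nonneg_left hA
      (show 0 ≤ 2 ^ (2 * r) * (1 / γ) ^ (1 / p) by positivity)
    have m3 := mul_le_mul_of_nonneg_left hE (show (0:ℝ) ≤ 2 ^ s by positivity)
    linarith
  -- (ii) implies (i)
  have h21 : (∃ C : ℝ, 0 < C ∧ ∀ n : ℕ, 1 ≤ n →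
        ellp p n (X n) (fun x => steklov r (γ / (n : ℝ)) f x - f x) +
          omegaMod s p f (1 / (n : ℝ)) ≤ C * (n : ℝ) ^ (-α)) →
      (∃ C : ℝ, 0 < C ∧ ∀ n : ℕ, 1 ≤ n →
        LpNorm p (fun x => f x - G n f x) ≤ C * (n : ℝ) ^ (-α)) := by
    rintro ⟨C, hC, hb⟩
    have hr0 : (0:ℝ) < r := by exact_mod_cast hr
    set c0 : ℝ := 2 ^ s * ((s:ℝ) + 2) ^ s with hc0
    set c1 : ℝ := (2 * 2 ^ (2 * r) * r) * (1 / γ) ^ (1 / p) with hc1e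
    set c2 : ℝ := 2 ^ (2 * r) * (1 / γ) ^ (1 / p) with hc2e
    have hc0p : 0 < c0 := by positivity
    have hc1p : 0 < c1 := by positivity
    have hc2p : 0 < c2 := by positivity
    refine ⟨(1 + K3 * c0 + K1 * (c2 * c0 + c1 + 1)) * C, by positivity, ?_⟩
    intro n hn
    have hn0 : (0:ℝ) < n := by exact_mod_cast hn
    obtain ⟨g, hgS, hg1, hg2⟩ := kfun_exists hp hs hf hn
    have hgm : MemLpT p g := hgS.mem hp
    have hGg : MemLpT p (G n g) := ((hc3 g hgm n hn).1).mem hp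
    have hgf : MemLpT p (fun x => g x - f x) := hgm.sub hp hf
    have hGgf : MemLpT p (G n (fun x => g x - f x)) := ((hc3 _ hgf n hn).1).mem hp
    have b := hb n hn
    set ω := omegaMod s p f (1 / (n:ℝ)) with hω
    have hω0 : 0 ≤ ω := omega_nonneg s
    set a := ellp p n (X n) (fun x => steklov r (γ / (n : ℝ)) f x - f x) with ha
    have ha0 : 0 ≤ a := ellp_nonneg _ _ _
    rw [← hc0] at hg2
    have t1 := LpNorm_add_le hp ((hf.sub hp hgm).add hp (hgm.sub hp hGg)) hGgf
    have t2 := LpNorm_add_le hp (hf.sub hp hgm) (hgm.sub hp hGg)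
    have e1 : (fun x => f x - g x + (g x - G n g x) + G n (fun x => g x - f x) x) =
        fun x => f x - G n f x := by
      ext x
      have : G n (fun x => g x - f x) x = G n g x - G n f x := by
        rw [hGform.2, hGform.2, hGform.2, ← Finset.sum_sub_distrib]
        exact Finset.sum_congr rfl fun k _ => by ring
      rw [this]; ring
    rw [e1] at t1
    have t3 := hc2' g hgS n hn
    have e3 : K3 / (n:ℝ) ^ s * LpNorm p (iteratedDeriv s g) =
        K3 * (1 / (n:ℝ) ^ s * LpNorm p (iteratedDeriv s g)) := by ring
    rw [e3] at t3
    have t4 := hc1 _ hgf n hn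
    have t5 := ellp_steklov_le hp hγ0 hX hn hr hgf
    have t6 := ellp_steklov_smooth_le hp hγ0 hγ1 hX hn hr hs hsr hgS
    rw [← hc1e, ← LpNorm_sub_comm f g] at t5
    rw [← hc2e] at t6
    have t7 : ellp p n (X n) (fun x => g x - f x) = ellp p n (X n) (fun x =>
        (f x - g x)) := ellp_congr _ _ _ _ fun k _ => by simp only [abs_sub_comm]
    have t8 := ellp_add_le hp n (X n) (fun x => (steklov r (γ / n) g x - g x) +
      (-1) * steklov r (γ / n) (fun x => g x - f x) x)
      (fun x => (-1) * (steklov r (γ / n) f x - f x))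
    have t9 := ellp_add_le hp n (X n) (fun x => (steklov r (γ / n) g x - g x))
      (fun x => (-1) * steklov r (γ / n) (fun x => g x - f x) x)
    have e8 : ellp p n (X n) (fun x => (-1) * (steklov r (γ / n) f x - f x)) = a :=
      ellp_congr _ _ _ _ fun k _ => by simp only [abs_mul, abs_neg, abs_one, one_mul]
    have e9 : ellp p n (X n) (fun x => (-1) * steklov r (γ / n) (fun x => g x - f x) x) =
        ellp p n (X n) (steklov r (γ / n) (fun x => g x - f x)) :=
      ellp_congr _ _ _ _ fun k _ => by simp only [abs_mul, abs_neg, abs_one, one_mul]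
    have e10 : (fun x => (steklov r (γ / n) g x - g x) +
      (-1) * steklov r (γ / n) (fun x => g x - f x) x + (-1) * (steklov r (γ / n) f x - f x)) =
        fun x => f x - g x := by
      ext x
      rw [steklov_sub hp hgm hf]; ring
    rw [e10, e8] at t8
    rw [e9] at t9
    rw [t7] at t4
    have m1 := mul_le_mul_of_nonneg_left hg1 hc1p.le
    have m2 := mul_le_mul_of_nonneg_left hg2 hc2p.le
    have m3 := mul_le_mul_of_nonneg_left hg2 hK3.le
    have t11 : ellp p n (X n) (fun x => f x - g x) ≤ (c2 * c0 + c1) * ω + a := by linarith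
    have m4 := mul_le_mul_of_nonneg_left t11 hK1.le
    have t12 : LpNorm p (fun x => f x - G n f x) ≤
        ω + K3 * (c0 * ω) + K1 * ((c2 * c0 + c1) * ω + a) := by linarith
    have t13 : ω + K3 * (c0 * ω) + K1 * ((c2 * c0 + c1) * ω + a) ≤
        (1 + K3 * c0 + K1 * (c2 * c0 + c1 + 1)) * (a + ω) := by
      have u1 : 0 ≤ (1 + K3 * c0 + K1 * (c2 * c0 + c1)) * a := by positivity
      have u2 : 0 ≤ K1 * ω := by positivity
      nlinarith
    have t14 := mul_le_mul_of_nonneg_left b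
      (show 0 ≤ 1 + K3 * c0 + K1 * (c2 * c0 + c1 + 1) by positivity)
    linarith
  exact ⟨⟨fun h => h132 h (h13 h), h21⟩, ⟨fun h => h13 (h21 h), fun h => h132 (h31 h) h⟩⟩
end

section
/- Let $f\in L_p(\mathbb{T})$, $1\le p<\infty$, $\delta>0$, and $n\in\mathbb{N}$, and suppose the sampling operators $G_n$ satisfy condition (c2') with $s=1$ and condition (c1'). Then $K_2\|f_\delta-f\|_{\ell_p(X_n)}-\big(1+\frac{K_3}{\delta n}\big)\,\omega_1(f,\delta)_p\le\|f-G_n(f)\|_p$. -/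
open MeasureTheory Filter Finset

namespace Stk

/-- Restricted measure on one period. -/
noncomputable abbrev mu : Measure ℝ := volume.restrict (Set.Ioc (0:ℝ) 1)

/-- Normalised measure on `(-δ/2, δ/2]`. -/
noncomputable def nu (δ : ℝ) : Measure ℝ :=
  (ENNReal.ofReal δ)⁻¹ • volume.restrict (Set.Ioc (-(δ/2)) (δ/2))

lemma nu_prob {δ : ℝ} (hδ : 0 < δ) : IsProbabilityMeasure (nu δ) := by
  constructor
  have h : ENNReal.ofReal δ ≠ 0 := by simpa using hδ
  simp only [nu, Measure.smul_apply, Measure.restrict_apply_univ, Real.volume_Ioc, smul_eq_mul]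
  rw [show δ / 2 - -(δ / 2) = δ by ring]
  exact ENNReal.inv_mul_cancel h ENNReal.ofReal_ne_top

lemma nu_int {δ : ℝ} (hδ : 0 < δ) (u : ℝ → ℝ) :
    ∫ t, u t ∂(nu δ) = δ⁻¹ * ∫ t in (-(δ/2))..(δ/2), u t := by
  rw [intervalIntegral.integral_of_le (by linarith), nu, integral_smul_measure]
  simp [ENNReal.toReal_ofReal hδ.le]

lemma nu_ae {δ : ℝ} : ∀ᵐ t ∂(nu δ), t ∈ Set.Ioc (-(δ/2)) (δ/2) := by
  have := ae_restrict_mem (μ := (volume : Measure ℝ)) (measurableSet_Ioc (a := -(δ/2)) (b := δ/2))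
  exact Measure.ae_smul_measure this _

lemma steklov_one (δ : ℝ) (f : ℝ → ℝ) (x : ℝ) :
    steklov 1 δ f x = δ⁻¹ * ∫ t in (-(δ/2))..(δ/2), f (x + t) := by
  simp [steklov]
  left
  ring

lemma p_facts {p : ℝ} (hp : 1 ≤ p) : (1 : ENNReal) ≤ ENNReal.ofReal p ∧ ENNReal.ofReal p ≠ 0 ∧
    ENNReal.ofReal p ≠ ⊤ ∧ (ENNReal.ofReal p).toReal = p := by
  refine ⟨by simpa using hp, by simp; linarith, ENNReal.ofReal_ne_top,
    ENNReal.toReal_ofReal (by linarith)⟩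

lemma LpNorm_eq {p : ℝ} (hp : 1 ≤ p) {u : ℝ → ℝ} (hu : MemLp u (ENNReal.ofReal p) mu) :
    LpNorm p u = (eLpNorm u (ENNReal.ofReal p) mu).toReal := by
  obtain ⟨h1, h2, h3, h4⟩ := p_facts hp
  rw [hu.eLpNorm_eq_integral_rpow_norm h2 h3, h4, LpNorm,
    intervalIntegral.integral_of_le zero_le_one, ENNReal.toReal_ofReal (by positivity)]
  simp [Real.norm_eq_abs]

lemma memLpT_iff {p : ℝ} (hp : 1 ≤ p) {u : ℝ → ℝ} (hm : Measurable u)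
    (hper : Function.Periodic u 1) : MemLpT p u ↔ MemLp u (ENNReal.ofReal p) mu := by
  obtain ⟨h1, h2, h3, h4⟩ := p_facts hp
  rw [← integrable_norm_rpow_iff hm.aestronglyMeasurable h2 h3, h4]
  simp only [MemLpT, hm, hper, true_and, Real.norm_eq_abs]
  rw [intervalIntegrable_iff_integrableOn_Ioc_of_le zero_le_one]
  rfl

lemma LpNorm_add {p : ℝ} (hp : 1 ≤ p) {u v : ℝ → ℝ} (hu : MemLp u (ENNReal.ofReal p) mu)
    (hv : MemLp v (ENNReal.ofReal p) mu) :
    LpNorm p (fun x => u x + v x) ≤ LpNorm p u + LpNorm p v := by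
  have huv : MemLp (fun x => u x + v x) (ENNReal.ofReal p) mu := hu.add hv
  rw [LpNorm_eq hp hu, LpNorm_eq hp hv, LpNorm_eq hp huv,
    ← ENNReal.toReal_add hu.eLpNorm_ne_top hv.eLpNorm_ne_top]
  apply ENNReal.toReal_mono (ENNReal.add_ne_top.2 ⟨hu.eLpNorm_ne_top, hv.eLpNorm_ne_top⟩)
  exact eLpNorm_add_le hu.1 hv.1 (p_facts hp).1

lemma LpNorm_smul {p : ℝ} (hp : 1 ≤ p) (c : ℝ) (u : ℝ → ℝ) :
    LpNorm p (fun x => c * u x) = |c| * LpNorm p u := by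
  simp only [LpNorm, abs_mul]
  simp_rw [Real.mul_rpow (abs_nonneg _) (abs_nonneg _)]
  rw [intervalIntegral.integral_const_mul, Real.mul_rpow (by positivity)
    (intervalIntegral.integral_nonneg zero_le_one fun x _ => by positivity),
    ← Real.rpow_mul (abs_nonneg _)]
  rw [mul_one_div_cancel (by linarith), Real.rpow_one]

lemma LpNorm_sum {p : ℝ} (hp : 1 ≤ p) (n : ℕ) (c : ℕ → ℝ) (u : ℕ → ℝ → ℝ)
    (hu : ∀ k, MemLp (u k) (ENNReal.ofReal p) mu) :
    MemLp (fun x => ∑ k ∈ Finset.range n, c k * u k x) (ENNReal.ofReal p) mu ∧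
    LpNorm p (fun x => ∑ k ∈ Finset.range n, c k * u k x) ≤
      ∑ k ∈ Finset.range n, |c k| * LpNorm p (u k) := by
  induction n with
  | zero =>
    have : p⁻¹ ≠ 0 := by positivity
    have h2 : p ≠ 0 := by positivity
    simp [LpNorm, Real.zero_rpow, this, h2]
  | succ n ih =>
    simp only [Finset.sum_range_succ]
    have h := (hu n).const_mul (c n)
    refine ⟨ih.1.add h, ?_⟩
    refine (LpNorm_add hp ih.1 h).trans ?_
    rw [LpNorm_smul hp]
    linarith [ih.2]

lemma LpNorm_bound {p : ℝ} (hp : 1 ≤ p) {u : ℝ → ℝ} {C : ℝ} (hC : 0 ≤ C)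
    (hm : Measurable u) (hu : ∀ x, |u x| ≤ C) :
    MemLp u (ENNReal.ofReal p) mu ∧ LpNorm p u ≤ C := by
  have h : MemLp u (ENNReal.ofReal p) mu :=
    MemLp.of_bound hm.aestronglyMeasurable C (Filter.Eventually.of_forall hu)
  refine ⟨h, ?_⟩
  rw [LpNorm_eq hp h]
  have := eLpNorm_le_of_ae_bound (p := ENNReal.ofReal p) (μ := mu) (f := u) (C := C)
    (Filter.Eventually.of_forall hu)
  simp at this
  calc _ ≤ (ENNReal.ofReal C).toReal := ENNReal.toReal_mono ENNReal.ofReal_ne_top this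
    _ = C := ENNReal.toReal_ofReal hC

lemma eLpNorm_shift {P : ENNReal} (h0 : P ≠ 0) (ht : P ≠ ⊤) {u : ℝ → ℝ} (hm : Measurable u)
    (hper : Function.Periodic u 1) (t : ℝ) :
    eLpNorm (fun x => u (x + t)) P mu = eLpNorm u P mu := by
  rw [eLpNorm_eq_lintegral_rpow_enorm_toReal h0 ht, eLpNorm_eq_lintegral_rpow_enorm_toReal h0 ht]
  congr 1
  have e1 : ∫⁻ x in Set.Ioc (0:ℝ) 1, ‖u (x + t)‖ₑ ^ P.toReal
      = ∫⁻ x in Set.Ioc t (t + 1), ‖u x‖ₑ ^ P.toReal := by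
    have hmp := measurePreserving_add_right (volume : Measure ℝ) t
    have := hmp.setLIntegral_comp_preimage (s := Set.Ioc t (t+1)) measurableSet_Ioc
      (f := fun x => ‖u x‖ₑ ^ P.toReal) (by fun_prop)
    rw [← this]
    simp
  rw [e1]
  have : VAddInvariantMeasure (AddSubgroup.zmultiples (1:ℝ)) ℝ volume :=
    ⟨fun c s _ => measure_preimage_add _ _ _⟩
  have h01 := isAddFundamentalDomain_Ioc (zero_lt_one (α := ℝ)) 0
  rw [zero_add] at h01
  refine IsAddFundamentalDomain.setLIntegral_eq (G := AddSubgroup.zmultiples (1:ℝ))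
    (isAddFundamentalDomain_Ioc zero_lt_one t) h01 _ ?_
  intro g x
  rw [hper.map_vadd_zmultiples]

lemma memLp_shift {p : ℝ} (hp : 1 ≤ p) {u : ℝ → ℝ} (hm : Measurable u)
    (hper : Function.Periodic u 1) (hu : MemLp u (ENNReal.ofReal p) mu) (t : ℝ) :
    MemLp (fun x => u (x + t)) (ENNReal.ofReal p) mu := by
  obtain ⟨h1, h2, h3, h4⟩ := p_facts hp
  refine ⟨(hm.comp (measurable_id.add_const t)).aestronglyMeasurable, ?_⟩
  rw [eLpNorm_shift h2 h3 hm hper]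
  exact hu.2

lemma LpNorm_shift {p : ℝ} (hp : 1 ≤ p) {u : ℝ → ℝ} (hm : Measurable u)
    (hper : Function.Periodic u 1) (hu : MemLp u (ENNReal.ofReal p) mu) (t : ℝ) :
    LpNorm p (fun x => u (x + t)) = LpNorm p u := by
  obtain ⟨h1, h2, h3, h4⟩ := p_facts hp
  rw [LpNorm_eq hp hu, LpNorm_eq hp (memLp_shift hp hm hper hu t), eLpNorm_shift h2 h3 hm hper]

/-- Averaging does not increase the norm. -/
lemma avg {p : ℝ} (hp : 1 ≤ p) {δ : ℝ} (hδ : 0 < δ) (F : ℝ → ℝ → ℝ)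
    (hF : Measurable (Function.uncurry F)) {C : ℝ} (hC : 0 ≤ C)
    (hM : ∀ t, MemLp (fun x => F x t) (ENNReal.ofReal p) mu)
    (hb : ∀ t ∈ Set.Ioc (-(δ/2)) (δ/2), LpNorm p (fun x => F x t) ≤ C) :
    MemLp (fun x => ∫ t, F x t ∂(nu δ)) (ENNReal.ofReal p) mu ∧
    LpNorm p (fun x => ∫ t, F x t ∂(nu δ)) ≤ C := by
  obtain ⟨h1, h2, h3, h4⟩ := p_facts hp
  have := nu_prob hδ
  have hp0 : 0 < p := by linarith
  have hm : StronglyMeasurable (fun x => ∫ t, F x t ∂(nu δ)) :=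
    (hF.stronglyMeasurable).integral_prod_right
  have key : eLpNorm (fun x => ∫ t, F x t ∂(nu δ)) (ENNReal.ofReal p) mu ≤ ENNReal.ofReal C := by
    rw [eLpNorm_eq_lintegral_rpow_enorm_toReal h2 h3, h4, one_div, ENNReal.rpow_inv_le_iff hp0]
    calc ∫⁻ x, ‖∫ t, F x t ∂(nu δ)‖ₑ ^ p ∂mu
        ≤ ∫⁻ x, ∫⁻ t, ‖F x t‖ₑ ^ p ∂(nu δ) ∂mu := by
          apply lintegral_mono
          intro x
          have hx : Measurable (F x) := hF.comp (by fun_prop : Measurable fun t : ℝ => (x, t))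
          have a1 : ‖∫ t, F x t ∂(nu δ)‖ₑ ≤ eLpNorm (F x) 1 (nu δ) := by
            rw [eLpNorm_one_eq_lintegral_enorm]
            exact enorm_integral_le_lintegral_enorm _
          have a2 := a1.trans (eLpNorm_le_eLpNorm_of_exponent_le h1 hx.aestronglyMeasurable)
          rw [eLpNorm_eq_lintegral_rpow_enorm_toReal h2 h3, h4, one_div,
            ENNReal.le_rpow_inv_iff hp0] at a2
          exact a2
      _ = ∫⁻ t, ∫⁻ x, ‖F x t‖ₑ ^ p ∂mu ∂(nu δ) := by
          apply lintegral_lintegral_swap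
          exact (hF.enorm.pow_const p).aemeasurable
      _ ≤ ∫⁻ t, ENNReal.ofReal C ^ p ∂(nu δ) := by
          apply lintegral_mono_ae
          filter_upwards [nu_ae] with t ht
          have b := hb t ht
          rw [LpNorm_eq hp (hM t)] at b
          have b2 := (ENNReal.le_ofReal_iff_toReal_le (hM t).eLpNorm_ne_top hC).2 b
          rw [eLpNorm_eq_lintegral_rpow_enorm_toReal h2 h3, h4, one_div,
            ENNReal.rpow_inv_le_iff hp0] at b2
          exact b2
      _ = _ := by simp
  have hM' : MemLp (fun x => ∫ t, F x t ∂(nu δ)) (ENNReal.ofReal p) mu :=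
    ⟨hm.aestronglyMeasurable, key.trans_lt ENNReal.ofReal_lt_top⟩
  refine ⟨hM', ?_⟩
  rw [LpNorm_eq hp hM']
  calc _ ≤ (ENNReal.ofReal C).toReal := ENNReal.toReal_mono ENNReal.ofReal_ne_top key
    _ = C := ENNReal.toReal_ofReal hC

/-- Local integrability. -/
lemma intInt {p : ℝ} (hp : 1 ≤ p) {u : ℝ → ℝ}
    (hper : Function.Periodic u 1) (hu : MemLp u (ENNReal.ofReal p) mu) (a b : ℝ) :
    IntervalIntegrable u volume a b := by
  have h : Integrable u mu := hu.integrable (p_facts hp).1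
  apply hper.intervalIntegrable (t := 0) one_ne_zero
  rw [zero_add, intervalIntegrable_iff_integrableOn_Ioc_of_le zero_le_one]
  exact h

/-- Primitive. -/
noncomputable def prim (u : ℝ → ℝ) (x : ℝ) : ℝ := ∫ y in (0:ℝ)..x, u y

lemma steklov_prim {u : ℝ → ℝ} (hu : ∀ a b, IntervalIntegrable u volume a b) (δ x : ℝ) :
    steklov 1 δ u x = δ⁻¹ * (prim u (x + δ/2) - prim u (x - δ/2)) := by
  rw [steklov_one, intervalIntegral.integral_comp_add_left (fun y => u y) x, prim, prim,
    intervalIntegral.integral_interval_sub_left (hu _ _) (hu _ _)]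
  rfl

lemma steklov_cont {u : ℝ → ℝ} (hu : ∀ a b, IntervalIntegrable u volume a b) (δ : ℝ) :
    Continuous (steklov 1 δ u) := by
  have hc : Continuous (prim u) := intervalIntegral.continuous_primitive hu 0
  have : steklov 1 δ u = fun x => δ⁻¹ * (prim u (x + δ/2) - prim u (x - δ/2)) :=
    funext (steklov_prim hu δ)
  rw [this]
  fun_prop

lemma steklov_per {u : ℝ → ℝ} (hu : Function.Periodic u 1) (δ : ℝ) :
    Function.Periodic (steklov 1 δ u) 1 := by
  intro x
  simp only [steklov_one]
  congr 2
  ext t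
  rw [show x + 1 + t = x + t + 1 by ring, hu]

lemma steklov_deriv {g : ℝ → ℝ} (hg : Continuous g) (ε x : ℝ) :
    HasDerivAt (steklov 1 ε g) (ε⁻¹ * (g (x + ε/2) - g (x - ε/2))) x := by
  have : steklov 1 ε g = fun x => ε⁻¹ * (prim g (x + ε/2) - prim g (x - ε/2)) :=
    funext (steklov_prim (fun a b => hg.intervalIntegrable a b) ε)
  rw [this]
  have hd : ∀ y, HasDerivAt (prim g) (g y) y := fun y => hg.integral_hasStrictDerivAt 0 y |>.hasDerivAt
  have h1 := (hd (x + ε/2)).comp_add_const x (ε/2)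
  have h2 := (hd (x - ε/2)).comp_sub_const x (ε/2)
  exact (h1.sub h2).const_mul _

lemma steklov_contDiff {g : ℝ → ℝ} (hg : Continuous g) (ε : ℝ) :
    ContDiff ℝ 1 (steklov 1 ε g) := by
  rw [contDiff_one_iff_deriv]
  refine ⟨fun x => (steklov_deriv hg ε x).differentiableAt, ?_⟩
  have : deriv (steklov 1 ε g) = fun x => ε⁻¹ * (g (x + ε/2) - g (x - ε/2)) :=
    funext fun x => (steklov_deriv hg ε x).deriv
  rw [this]
  fun_prop

lemma steklov_comm {u : ℝ → ℝ} (hu : ∀ a b, IntervalIntegrable u volume a b) (δ ε x : ℝ) :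
    ε⁻¹ * (steklov 1 δ u (x + ε/2) - steklov 1 δ u (x - ε/2)) =
      steklov 1 ε (fun y => δ⁻¹ * (u (y + δ/2) - u (y - δ/2))) x := by
  have i1 : ∀ a b, IntervalIntegrable (fun y => u (y + δ/2)) volume a b := fun a b => by
    simpa using (hu (a + δ/2) (b + δ/2)).comp_add_right (δ/2)
  have i2 : ∀ a b, IntervalIntegrable (fun y => u (y - δ/2)) volume a b := fun a b => by
    simpa using (hu (a - δ/2) (b - δ/2)).comp_sub_right (δ/2)
  rw [steklov_prim hu, steklov_prim hu, steklov_one,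
    intervalIntegral.integral_comp_add_left (fun y => δ⁻¹ * (u (y + δ/2) - u (y - δ/2))) x,
    intervalIntegral.integral_const_mul, intervalIntegral.integral_sub (i1 _ _) (i2 _ _),
    intervalIntegral.integral_comp_add_right, intervalIntegral.integral_comp_sub_right]
  simp only [prim]
  rw [← intervalIntegral.integral_interval_sub_left (hu 0 (x + ε/2 + δ/2))
      (hu 0 (x + -(ε/2) + δ/2)),
    ← intervalIntegral.integral_interval_sub_left (hu 0 (x + ε/2 - δ/2))
      (hu 0 (x + -(ε/2) - δ/2))]
  rw [show x - ε/2 = x + -(ε/2) by ring]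
  ring

lemma steklov_approx {g : ℝ → ℝ} (hg : Continuous g) (hper : Function.Periodic g 1)
    {η : ℝ} (hη : 0 < η) : ∃ ε > 0, ∀ x, |steklov 1 ε g x - g x| ≤ η := by
  have huc : UniformContinuousOn g (Set.Icc (-1) 2) :=
    isCompact_Icc.uniformContinuousOn_of_continuous hg.continuousOn
  rw [Metric.uniformContinuousOn_iff] at huc
  obtain ⟨d, hd, h⟩ := huc η hη
  refine ⟨min d 1, by positivity, ?_⟩
  set ε := min d 1 with hε
  have hε0 : 0 < ε := by positivity
  have he1 : ε ≤ d := min_le_left _ _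
  have he2 : ε ≤ 1 := min_le_right _ _
  have hpt : ∀ x t, |t| ≤ ε/2 → |g (x + t) - g x| ≤ η := by
    intro x t ht
    have e1 : g x = g (Int.fract x) := by
      conv_lhs => rw [← Int.fract_add_floor x]
      simpa using hper.int_mul ⌊x⌋ (Int.fract x)
    have e2 : g (x + t) = g (Int.fract x + t) := by
      conv_lhs => rw [← Int.fract_add_floor x]
      rw [show Int.fract x + (⌊x⌋ : ℝ) + t = Int.fract x + t + ⌊x⌋ by ring]
      simpa using hper.int_mul ⌊x⌋ (Int.fract x + t)
    rw [e1, e2]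
    have f0 := Int.fract_nonneg x
    have f1 := Int.fract_lt_one x
    have ht' := abs_le.1 ht
    have := h (Int.fract x + t) ⟨by linarith, by linarith⟩ (Int.fract x) ⟨by linarith, by linarith⟩
      (by rw [Real.dist_eq]; simp; linarith)
    exact this.le
  intro x
  have e : steklov 1 ε g x - g x = ε⁻¹ * ∫ t in (-(ε/2))..(ε/2), (g (x + t) - g x) := by
    rw [steklov_one, intervalIntegral.integral_sub
      (Continuous.intervalIntegrable (by fun_prop) _ _) (by simp)]
    simp
    field_simp
  rw [e, abs_mul, abs_of_pos (inv_pos.2 hε0)]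
  have := intervalIntegral.norm_integral_le_of_norm_le_const (a := -(ε/2)) (b := ε/2)
    (f := fun t => g (x + t) - g x) (C := η) (by
      intro t ht
      rw [Set.uIoc_of_le (by linarith)] at ht
      exact hpt x t (abs_le.2 ⟨ht.1.le, ht.2⟩))
  rw [show ε/2 - -(ε/2) = ε by ring, abs_of_pos hε0, Real.norm_eq_abs] at this
  calc _ ≤ ε⁻¹ * (η * ε) := by gcongr
    _ = η := by field_simp


lemma memLp_diff {p : ℝ} (hp : 1 ≤ p) {f : ℝ → ℝ} (hm : Measurable f)
    (hper : Function.Periodic f 1) (hf : MemLp f (ENNReal.ofReal p) mu) (t : ℝ) :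
    MemLp (fun x => f (x + t) - f x) (ENNReal.ofReal p) mu :=
  (memLp_shift hp hm hper hf t).sub hf

lemma omega_pos {p : ℝ} (hp : 1 ≤ p) {f : ℝ → ℝ} (hm : Measurable f)
    (hper : Function.Periodic f 1) (hf : MemLp f (ENNReal.ofReal p) mu) {δ h : ℝ}
    (h0 : 0 < h) (h1 : h < δ) : LpNorm p (fun x => f (x + h) - f x) ≤ omegaMod 1 p f δ := by
  have hD : ∀ h, Delta 1 h f = fun x => f (x + h) - f x := by
    intro h
    ext x
    simp [Delta, Finset.sum_range_succ]
    ring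
  apply le_csSup
  · refine ⟨LpNorm p f + LpNorm p f, ?_⟩
    rintro y ⟨h, _, _, rfl⟩
    rw [hD]
    have e : (fun x => f (x + h) - f x) = fun x => f (x + h) + (-1) * f x := by
      ext x; ring
    rw [e]
    refine (LpNorm_add hp (memLp_shift hp hm hper hf h) (hf.const_mul (-1))).trans ?_
    rw [LpNorm_shift hp hm hper hf, LpNorm_smul hp]
    simp
  · exact ⟨h, h0, h1, by rw [hD]⟩

lemma LpNorm_nonneg (p : ℝ) (f : ℝ → ℝ) : 0 ≤ LpNorm p f :=
  Real.rpow_nonneg (intervalIntegral.integral_nonneg zero_le_one fun x _ => by positivity) _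

lemma omega_nonneg {p : ℝ} (hp : 1 ≤ p) {f : ℝ → ℝ} (hm : Measurable f)
    (hper : Function.Periodic f 1) (hf : MemLp f (ENNReal.ofReal p) mu) {δ : ℝ}
    (h0 : 0 < δ) : 0 ≤ omegaMod 1 p f δ :=
  (LpNorm_nonneg _ _).trans (omega_pos hp hm hper hf (half_pos h0) (half_lt_self h0))

lemma omega_abs {p : ℝ} (hp : 1 ≤ p) {f : ℝ → ℝ} (hm : Measurable f)
    (hper : Function.Periodic f 1) (hf : MemLp f (ENNReal.ofReal p) mu) {δ t : ℝ}
    (h1 : |t| < δ) : LpNorm p (fun x => f (x + t) - f x) ≤ omegaMod 1 p f δ := by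
  rcases lt_trichotomy t 0 with h | h | h
  · have e : (fun x => f (x + t) - f x) =
        fun x => (-1) * (fun y => (fun z => f (z + -t) - f z) (y + t)) x := by
      ext x
      simp
    have hper' : Function.Periodic (fun z => f (z + -t) - f z) 1 := by
      intro x
      simp only
      rw [hper x, show x + 1 + -t = x + -t + 1 by ring, hper]
    rw [e, LpNorm_smul hp, LpNorm_shift hp (by fun_prop) hper' (memLp_diff hp hm hper hf _)]
    rw [abs_of_neg h] at h1
    simpa using omega_pos hp hm hper hf (neg_pos.2 h) h1
  · have hδ : 0 < δ := by simpa [h] using h1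
    have h2 : p⁻¹ ≠ 0 := by positivity
    have h3 : p ≠ 0 := by positivity
    simpa [h, LpNorm, Real.zero_rpow, h2, h3] using omega_nonneg hp hm hper hf hδ
  · rw [abs_of_pos h] at h1
    exact omega_pos hp hm hper hf h h1

lemma steklov_nu {d : ℝ} (hd : 0 < d) (f : ℝ → ℝ) (x : ℝ) :
    steklov 1 d f x = ∫ t, f (x + t) ∂(nu d) := by
  rw [nu_int hd, steklov_one]

/-- `‖f_d - f‖ ≤ ω`. -/
lemma steklov_sub {p : ℝ} (hp : 1 ≤ p) {f : ℝ → ℝ} (hm : Measurable f)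
    (hper : Function.Periodic f 1) (hf : MemLp f (ENNReal.ofReal p) mu) {δ d : ℝ}
    (hd : 0 < d) (h1 : d < δ) :
    MemLp (fun x => steklov 1 d f x - f x) (ENNReal.ofReal p) mu ∧
    LpNorm p (fun x => steklov 1 d f x - f x) ≤ omegaMod 1 p f δ := by
  have hp1 := nu_prob hd
  have hi := intInt hp hper hf
  have e : (fun x => steklov 1 d f x - f x) = fun x => ∫ t, (f (x + t) - f x) ∂(nu d) := by
    ext x
    rw [nu_int hd, steklov_one, intervalIntegral.integral_sub _ (by simp)]
    · simp
      field_simp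
    · simpa using (hi (-(d/2) + x) (d/2 + x)).comp_add_left x
  rw [e]
  apply avg hp hd (fun x t => f (x + t) - f x)
  · simp only [Function.uncurry_def]
    fun_prop
  · exact omega_nonneg hp hm hper hf (hd.trans h1)
  · exact memLp_diff hp hm hper hf
  · intro t ht
    apply omega_abs hp hm hper hf
    rw [abs_lt]
    constructor <;> linarith [ht.1, ht.2]

/-- Bound for the derivative of the double average. -/
lemma steklov_der {p : ℝ} (hp : 1 ≤ p) {f : ℝ → ℝ} (hm : Measurable f)
    (hper : Function.Periodic f 1) (hf : MemLp f (ENNReal.ofReal p) mu) {δ d ε : ℝ}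
    (hd : 0 < d) (h1 : d < δ) (hε : 0 < ε) :
    LpNorm p (iteratedDeriv 1 (steklov 1 ε (steklov 1 d f))) ≤ d⁻¹ * omegaMod 1 p f δ := by
  have hi := intInt hp hper hf
  set D : ℝ → ℝ := fun y => d⁻¹ * (f (y + d/2) - f (y - d/2)) with hD
  have eD : D = fun y => d⁻¹ * (fun x => (fun z => f (z + d) - f z) (x + -(d/2))) y := by
    ext y
    simp only [hD]
    congr 3 <;> ring
  have hper1 : Function.Periodic (fun z => f (z + d) - f z) 1 := by
    intro x
    simp only
    rw [hper x, show x + 1 + d = x + d + 1 by ring, hper]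
  have hM1 := memLp_shift hp (by fun_prop) hper1 (memLp_diff hp hm hper hf d) (-(d/2))
  have hDM : MemLp D (ENNReal.ofReal p) mu := by
    rw [eD]
    exact hM1.const_mul _
  have hDm : Measurable D := by fun_prop
  have hDn : LpNorm p D ≤ d⁻¹ * omegaMod 1 p f δ := by
    rw [eD, LpNorm_smul hp, LpNorm_shift hp (by fun_prop) hper1 (memLp_diff hp hm hper hf d),
      abs_of_pos (inv_pos.2 hd)]
    gcongr
    exact omega_pos hp hm hper hf hd h1
  have hDper : Function.Periodic D 1 := by
    intro x
    simp only [hD]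
    rw [show x + 1 + d/2 = x + d/2 + 1 by ring, show x + 1 - d/2 = x - d/2 + 1 by ring, hper, hper]
  have e : iteratedDeriv 1 (steklov 1 ε (steklov 1 d f)) = fun x => ∫ t, D (x + t) ∂(nu ε) := by
    ext x
    rw [iteratedDeriv_one, (steklov_deriv (steklov_cont hi d) ε x).deriv, steklov_comm hi,
      steklov_nu hε]
  rw [e]
  refine (avg hp hε (fun x t => D (x + t)) ?_ ((LpNorm_nonneg _ _).trans hDn) ?_ ?_).2
  · simp only [Function.uncurry_def]
    fun_prop
  · exact memLp_shift hp hDm hDper hDM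
  · intro t _
    rw [LpNorm_shift hp hDm hDper hDM]
    exact hDn

lemma main {p δ : ℝ} {n : ℕ} {X : ℕ → ℕ → ℝ} {φ : ℕ → ℕ → ℝ → ℝ}
    {G : ℕ → (ℝ → ℝ) → ℝ → ℝ}
    (hp : 1 ≤ p) (hn : 1 ≤ n) (hGform : SamplingForm p X φ G)
    {K2 : ℝ} (hc1' : CondC1' p K2 X G) {K3 : ℝ} (hK3 : 0 < K3)
    (hc2' : CondC2' p K3 1 G)
    {f : ℝ → ℝ} (hf : MemLpT p f) {d : ℝ} (hd : 0 < d) (h1 : d < δ) :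
    K2 * ellp p n (X n) (fun x => steklov 1 d f x - f x) -
        (1 + K3 / (d * (n : ℝ))) * omegaMod 1 p f δ ≤
      LpNorm p (fun x => f x - G n f x) := by
  have hper := hf.1
  have hm := hf.2.1
  have hfM := (memLpT_iff hp hm hper).1 hf
  have hi := intInt hp hper hfM
  have hφ : ∀ k, MemLp (φ n k) (ENNReal.ofReal p) mu := fun k =>
    (memLpT_iff hp (hGform.1 n k).2.1 (hGform.1 n k).1).1 (hGform.1 n k)
  have hG : ∀ u, G n u = fun x => ∑ k ∈ Finset.range n, u (X n k) * φ n k x :=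
    fun u => funext (hGform.2 n u)
  have hGM : ∀ u, MemLp (G n u) (ENNReal.ofReal p) mu := fun u => by
    rw [hG]
    exact (LpNorm_sum hp n _ _ hφ).1
  set g := steklov 1 d f with hg
  have hgc : Continuous g := steklov_cont hi d
  have hgper : Function.Periodic g 1 := steklov_per hper d
  obtain ⟨hsM, hsn⟩ := steklov_sub hp hm hper hfM hd h1
  set ω := omegaMod 1 p f δ with hω
  have hgM : MemLp g (ENNReal.ofReal p) mu := by
    have := hsM.add hfM
    convert this using 1
    ext x
    simp [hg]
  set S := ∑ k ∈ Finset.range n, LpNorm p (φ n k) with hS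
  have hS0 : 0 ≤ S := Finset.sum_nonneg fun k _ => LpNorm_nonneg _ _
  have hn0 : (0:ℝ) < n := by exact_mod_cast hn
  -- the approximation condition extended to g
  have hgG : LpNorm p (fun x => g x - G n g x) ≤ K3 / (d * n) * ω := by
    apply le_of_forall_pos_le_add
    intro η hη
    obtain ⟨ε, hε, happ⟩ := steklov_approx hgc hgper (η := η / (1 + S)) (by positivity)
    set v := steklov 1 ε g with hv
    have hvc : ContDiff ℝ 1 v := steklov_contDiff hgc ε
    have hvper : Function.Periodic v 1 := steklov_per hgper ε
    have hA := hc2' v ⟨hvper, by exact_mod_cast hvc⟩ n hn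
    have hB := steklov_der hp hm hper hfM hd h1 hε
    obtain ⟨hvg, hvgn⟩ := LpNorm_bound (u := fun x => v x - g x) hp (by positivity)
      (hvc.continuous.sub hgc).measurable happ
    have hvM : MemLp v (ENNReal.ofReal p) mu := by
      have := hvg.add hgM
      convert this using 1
      ext x
      simp
    have e : (fun x => g x - G n g x) = fun x => ((-1) * (v x - g x) +
        (v x - G n v x)) + ∑ k ∈ Finset.range n, (v (X n k) - g (X n k)) * φ n k x := by
      ext x
      simp only [hG, sub_mul, Finset.sum_sub_distrib]
      ring
    obtain ⟨q1, q2⟩ := LpNorm_sum hp n (fun k => v (X n k) - g (X n k)) _ hφ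
    have q3 : ∑ k ∈ Finset.range n, |v (X n k) - g (X n k)| * LpNorm p (φ n k) ≤
        η / (1 + S) * S := by
      rw [hS, Finset.mul_sum]
      exact Finset.sum_le_sum fun k _ =>
        mul_le_mul_of_nonneg_right (happ _) (LpNorm_nonneg _ _)
    have r1 := LpNorm_add hp ((hvg.const_mul (-1)).add (hvM.sub (hGM v))) q1
    have r2 := LpNorm_add hp (hvg.const_mul (-1)) (hvM.sub (hGM v))
    rw [LpNorm_smul hp] at r2
    simp only [abs_neg, abs_one, one_mul] at r2
    have r3 : K3 / (n:ℝ)^1 * LpNorm p (iteratedDeriv 1 v) ≤ K3 / (d * n) * ω := by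
      calc _ ≤ K3 / (n:ℝ)^1 * (d⁻¹ * ω) := by gcongr
        _ = _ := by field_simp
    have r4 : η / (1 + S) + η / (1 + S) * S = η := by field_simp
    rw [e]
    simp only [Pi.add_apply, Pi.sub_apply] at r1 r2 hA
    have r1' : LpNorm p (fun x => ((-1) * (v x - g x) +
        (v x - G n v x)) + ∑ k ∈ Finset.range n, (v (X n k) - g (X n k)) * φ n k x) ≤
        LpNorm p (fun x => (-1) * (v x - g x) + (v x - G n v x)) +
        LpNorm p (fun x => ∑ k ∈ Finset.range n, (v (X n k) - g (X n k)) * φ n k x) := r1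
    have r2' : LpNorm p (fun x => (-1) * (v x - g x) + (v x - G n v x)) ≤
        LpNorm p (fun x => v x - g x) + LpNorm p (fun x => v x - G n v x) := r2
    linarith
  have hC1 := hc1' (fun x => g x - f x) ((memLpT_iff hp (hgc.measurable.sub hm) (by
    intro x
    change g (x + 1) - f (x + 1) = g x - f x
    rw [hper, hgper])).2 hsM) n hn
  have e : G n (fun x => g x - f x) = fun x => ((f x - G n f x) + (g x - f x)) +
      (-1) * (g x - G n g x) := by
    ext x
    simp only [hG, sub_mul, Finset.sum_sub_distrib]
    ring
  have r1 : LpNorm p (fun x => ((f x - G n f x) + (g x - f x)) + (-1) * (g x - G n g x)) ≤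
      LpNorm p (fun x => (f x - G n f x) + (g x - f x)) +
      LpNorm p (fun x => (-1) * (g x - G n g x)) :=
    LpNorm_add hp ((hfM.sub (hGM f)).add hsM) ((hgM.sub (hGM g)).const_mul (-1))
  have r2 : LpNorm p (fun x => (f x - G n f x) + (g x - f x)) ≤
      LpNorm p (fun x => f x - G n f x) + LpNorm p (fun x => g x - f x) :=
    LpNorm_add hp (hfM.sub (hGM f)) hsM
  rw [LpNorm_smul hp (-1) (fun x => g x - G n g x)] at r1
  simp only [abs_neg, abs_one, one_mul] at r1
  rw [e] at hC1
  linarith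

end Stk

theorem stmt16 (p δ : ℝ) (n : ℕ) (X : ℕ → ℕ → ℝ) (φ : ℕ → ℕ → ℝ → ℝ)
    (G : ℕ → (ℝ → ℝ) → ℝ → ℝ)
    (hp : 1 ≤ p) (hδ : 0 < δ) (hn : 1 ≤ n)
    (hX : NodesOrd X) (hGform : SamplingForm p X φ G)
    (K2 : ℝ) (hK2 : 0 < K2) (hc1' : CondC1' p K2 X G) (K3 : ℝ) (hK3 : 0 < K3) (hc2' : CondC2' p K3 1 G)
    (f : ℝ → ℝ) (hf : MemLpT p f) :
    K2 * ellp p n (X n) (fun x => steklov 1 δ f x - f x) -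
        (1 + K3 / (δ * (n : ℝ))) * omegaMod 1 p f δ ≤
      LpNorm p (fun x => f x - G n f x) := by
  have hper := hf.1
  have hm := hf.2.1
  have hfM := (Stk.memLpT_iff hp hm hper).1 hf
  have hi := Stk.intInt hp hper hfM
  have hn0 : (n:ℝ) ≠ 0 := by
    have : (0:ℝ) < n := by exact_mod_cast hn
    exact this.ne'
  have hpc : Continuous (Stk.prim f) := intervalIntegral.continuous_primitive hi 0
  have hs : ∀ x, ContinuousAt (fun d => steklov 1 d f x) δ := by
    intro x
    simp only [Stk.steklov_prim hi]
    have hδ' := hδ.ne'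
    have a : ContinuousAt (fun d : ℝ => d⁻¹) δ := continuousAt_inv₀ hδ'
    exact a.mul (by fun_prop : Continuous fun d => Stk.prim f (x + d/2) -
      Stk.prim f (x - d/2)).continuousAt
  have hcont : ContinuousAt (fun d => K2 * ellp p n (X n) (fun x => steklov 1 d f x - f x) -
        (1 + K3 / (d * (n : ℝ))) * omegaMod 1 p f δ) δ := by
    have hp0 : 0 ≤ p := by linarith
    apply ContinuousAt.sub
    · apply continuousAt_const.mul
      unfold ellp
      apply ContinuousAt.rpow_const _ (Or.inr (by positivity))
      apply continuousAt_const.mul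
      apply tendsto_finsetSum
      intro k _
      exact ContinuousAt.rpow_const ((hs (X n k)).sub continuousAt_const).abs (Or.inr hp0)
    · apply ContinuousAt.mul _ continuousAt_const
      apply continuousAt_const.add
      exact continuousAt_const.div (continuousAt_id.mul continuousAt_const)
        (mul_ne_zero hδ.ne' hn0)
  refine le_of_tendsto (hcont.tendsto.mono_left (nhdsWithin_le_nhds (s := Set.Iio δ))) ?_
  filter_upwards [self_mem_nhdsWithin, nhdsWithin_le_nhds (lt_mem_nhds hδ)] with d h1 h2
  exact Stk.main hp hn hGform hc1' hK3 hc2' hf h2 h1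
end
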